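/- arXiv:math/0402310 — 3 statements merged into one kernel-verified Lean document; each statement's English description precedes it below -/
import Mathlib

section
/- Let R be a commutative Noetherian ring of finite Krull dimension, let a be an ideal of R, and let M and N be finitely generated R-modules with M of finite projective dimension. Then for all integers i, j ≥ 0 with H^j_a(Ext^i_R(M,N)) ≠ 0, one has i + j ≤ cd(a, M ⊗_R N) + proj.dim_R M; equivalently, sup over i of (cd(a, Ext^i_R(M,N)) + i) ≤ cd(a, M ⊗_R N) + proj.dim_R M. (This is the module case of Theorem 3.2(ii), answering affirmatively the question: does cd(a, RHom_R(M,N)) ≤ cd(a, M ⊗_R N) + proj.dim M hold for finitely generated modules M, N with proj.dim M < ∞?) -/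
/-!
Common definitions: Ext modules, dimension of a module (Krull dimension of its
support, in `WithBot ℕ∞`, with `⊥` for the zero module), projective/injective
dimension via the Ext-vanishing characterization, and cohomological dimension
with respect to an ideal via local cohomology.
-/

open CategoryTheory TensorProduct

universe u

/-- The `i`-th Ext module `Ext^i_R(M, N)` of two `R`-modules. -/
noncomputable def extMod (R : Type u) [CommRing R] (i : ℕ) (M N : ModuleCat.{u} R) :
    ModuleCat.{u} R :=
  ((Ext R (ModuleCat.{u} R) i).obj (Opposite.op M)).obj N

/-- The dimension `dim_R M` of an `R`-module: the Krull dimension of its support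
`Supp_R M ⊆ Spec R`, an element of `WithBot ℕ∞` which is `⊥ = -∞` for the zero module. -/
noncomputable def supportDim (R : Type u) [CommRing R] (M : Type u) [AddCommGroup M]
    [Module R M] : WithBot ℕ∞ :=
  Order.krullDim (Module.support R M)

/-- `M` has projective dimension at most `n`: `Ext^{n+1}_R(M, N) = 0` for every `N`. -/
def projDimLE (R : Type u) [CommRing R] (M : ModuleCat.{u} R) (n : ℕ) : Prop :=
  ∀ N : ModuleCat.{u} R, Subsingleton (extMod R (n + 1) M N)

/-- The projective dimension `proj.dim_R M`, as an element of `WithBot ℕ∞`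
(it is `⊤` when `M` does not have finite projective dimension). -/
noncomputable def projDim (R : Type u) [CommRing R] (M : ModuleCat.{u} R) : WithBot ℕ∞ :=
  sInf {d : WithBot ℕ∞ | ∃ n : ℕ, d = n ∧ projDimLE R M n}

/-- `N` has injective dimension at most `n`: `Ext^{n+1}_R(M, N) = 0` for every `M`. -/
def injDimLE (R : Type u) [CommRing R] (N : ModuleCat.{u} R) (n : ℕ) : Prop :=
  ∀ M : ModuleCat.{u} R, Subsingleton (extMod R (n + 1) M N)

/-- The cohomological dimension `cd(a, M)`: the supremum of those `i` with
`H^i_a(M) ≠ 0`, an element of `WithBot ℕ∞` which is `⊥ = -∞` when all the local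
cohomology modules vanish. -/
noncomputable def cohDim (R : Type u) [CommRing R] (a : Ideal R) (M : ModuleCat.{u} R) :
    WithBot ℕ∞ :=
  ⨆ i ∈ {i : ℕ | ¬ Subsingleton ((localCohomology a i).obj M)}, (i : WithBot ℕ∞)

namespace ExtComparison

open Limits

variable {R : Type u} [CommRing R] {X X' : ModuleCat.{u} R}

/-- The functor whose left derived functors are the modules `extMod`. -/
noncomputable abbrev homFunctor (Y : ModuleCat.{u} R) :
    ModuleCat.{u} R ⥤ (ModuleCat.{u} R)ᵒᵖ :=
  ((linearYoneda R (ModuleCat.{u} R)).obj Y).rightOp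

/-- The complex `Hom(P, Y)`, as a chain complex in the opposite category. -/
noncomputable abbrev homComplex (P : ProjectiveResolution X) (Y : ModuleCat.{u} R) :
    ChainComplex (ModuleCat.{u} R)ᵒᵖ ℕ :=
  ((homFunctor Y).mapHomologicalComplex _).obj P.complex

/-- The inclusion of cocycles into cochains. -/
noncomputable def cocyclesInc (P : ProjectiveResolution X) (Y : ModuleCat.{u} R) (n : ℕ) :
    ((homComplex P Y).opcycles n).unop ⟶ ModuleCat.of R (P.complex.X n ⟶ Y) :=
  ((homComplex P Y).pOpcycles n).unop

/-- The comparison of `extMod` with the cohomology of `Hom(P, Y)`. -/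
noncomputable def homologyIso (P : ProjectiveResolution X) (Y : ModuleCat.{u} R) (n : ℕ) :
    ((homFunctor Y).leftDerived n).obj X ≅ (homComplex P Y).homology n :=
  P.isoLeftDerivedObj (homFunctor Y) n

/-- The projection of cocycles onto cohomology. -/
noncomputable def cocyclesProj (P : ProjectiveResolution X) (Y : ModuleCat.{u} R) (n : ℕ) :
    ((homComplex P Y).opcycles n).unop ⟶ extMod R n X Y :=
  ((homologyIso P Y n).hom ≫ (homComplex P Y).homologyι n).unop

/-- The contravariant functoriality of `extMod`. -/
noncomputable def extModMap (n : ℕ) (g : X' ⟶ X) (Y : ModuleCat.{u} R) :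
    extMod R n X Y ⟶ extMod R n X' Y :=
  ((Ext R (ModuleCat.{u} R) n).map g.op).app Y

variable (P : ProjectiveResolution X) (P' : ProjectiveResolution X') (Y : ModuleCat.{u} R) (n : ℕ)

lemma cocyclesInc_injective : Function.Injective (cocyclesInc P Y n) := by
  rw [← ModuleCat.mono_iff_injective]
  exact unop_mono_of_epi _

lemma cocyclesProj_surjective : Function.Surjective (cocyclesProj P Y n) := by
  rw [← ModuleCat.epi_iff_surjective]
  exact unop_epi_of_mono _

lemma d_comp_cocyclesInc (z : ((homComplex P Y).opcycles n).unop) :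
    P.complex.d (n + 1) n ≫ (show P.complex.X n ⟶ Y from cocyclesInc P Y n z) = 0 := by
  have := congrArg Quiver.Hom.unop ((homComplex P Y).d_pOpcycles (n + 1) n)
  exact congr($this z)

lemma exists_cocyclesInc_eq (f : P.complex.X n ⟶ Y) (hf : P.complex.d (n + 1) n ≫ f = 0) :
    ∃ z, cocyclesInc P Y n z = f := by
  have h1 := ShortComplex.exact_of_g_is_cokernel
    (ShortComplex.mk _ _ ((homComplex P Y).d_pOpcycles (n + 1) n))
    ((homComplex P Y).opcyclesIsCokernel (n + 1) n (by simp))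
  have h2 := h1.unop
  rw [ShortComplex.moduleCat_exact_iff] at h2
  exact h2 f hf

lemma cocyclesProj_eq_zero_iff (z : ((homComplex P Y).opcycles n).unop) :
    cocyclesProj P Y n z = 0 ↔
      ∃ g, P.complex.d n ((ComplexShape.down ℕ).next n) ≫ g = cocyclesInc P Y n z := by
  let K := homComplex P Y
  let m := (ComplexShape.down ℕ).next n
  have h1 := ShortComplex.exact_of_f_is_kernel
    (ShortComplex.mk _ _ (K.homologyι_comp_fromOpcycles n m)) (K.homologyIsKernel n m rfl)
  have h2 := h1.unop
  rw [ShortComplex.moduleCat_exact_iff] at h2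
  have h3 : ∀ g : P.complex.X m ⟶ Y, cocyclesInc P Y n ((K.fromOpcycles n m).unop g) =
      P.complex.d n m ≫ g := by
    intro g
    have := congrArg Quiver.Hom.unop (K.p_fromOpcycles n m)
    exact congr($this g)
  have h4 : cocyclesProj P Y n z = 0 ↔ (K.homologyι n).unop z = 0 := by
    have : cocyclesProj P Y n z =
      (homologyIso P Y n).hom.unop ((K.homologyι n).unop z) := rfl
    rw [this]
    have hinj : Function.Injective (homologyIso P Y n).hom.unop := by
      rw [← ModuleCat.mono_iff_injective]
      exact unop_mono_of_epi _
    exact map_eq_zero_iff _ hinj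
  rw [h4]
  constructor
  · intro h
    obtain ⟨g, hg⟩ := h2 z h
    exact ⟨g, (h3 g).symm.trans (congrArg _ hg)⟩
  · rintro ⟨g, hg⟩
    rw [← cocyclesInc_injective P Y n ((h3 g).trans hg)]
    have := congrArg Quiver.Hom.unop (K.homologyι_comp_fromOpcycles n m)
    exact congr($this g)

variable {P P'} in
lemma extModMap_cocyclesProj {g : X' ⟶ X} (φ : ProjectiveResolution.Hom P' P g)
    (z : ((homComplex P Y).opcycles n).unop) :
    ∃ z', cocyclesInc P' Y n z' = φ.hom.f n ≫ (show P.complex.X n ⟶ Y from cocyclesInc P Y n z) ∧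
      cocyclesProj P' Y n z' = extModMap n g Y (cocyclesProj P Y n z) := by
  let ψ := ((homFunctor Y).mapHomologicalComplex _).map φ.hom
  refine ⟨(HomologicalComplex.opcyclesMap ψ n).unop z, ?_, ?_⟩
  · have := congrArg Quiver.Hom.unop (HomologicalComplex.p_opcyclesMap ψ n)
    exact congr($this z)
  · have h0 : φ.hom.f 0 ≫ P.π.f 0 = P'.π.f 0 ≫ g := φ.hom_f_zero_comp_π_f_zero
    have h1 : ((homFunctor Y).leftDerived n).map g ≫ (homologyIso P Y n).hom =
        (homologyIso P' Y n).hom ≫ HomologicalComplex.homologyMap ψ n :=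
      ProjectiveResolution.isoLeftDerivedObj_hom_naturality g P' P φ.hom h0 (homFunctor Y) n
    have h2 := HomologicalComplex.homologyι_naturality ψ n
    have h3 : ((homFunctor Y).leftDerived n).map g ≫
        (homologyIso P Y n).hom ≫ (homComplex P Y).homologyι n =
        ((homologyIso P' Y n).hom ≫ (homComplex P' Y).homologyι n) ≫
          HomologicalComplex.opcyclesMap ψ n := by
      rw [reassoc_of% h1, Category.assoc, ← h2]
    have := congrArg Quiver.Hom.unop h3
    exact congr($this.symm z)

lemma extMk_eq_zero_iff (f : P.complex.X n ⟶ Y) (hf : P.complex.d (n + 1) n ≫ f = 0) :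
    P.extMk f (n + 1) rfl hf = 0 ↔
      ∃ g, P.complex.d n ((ComplexShape.down ℕ).next n) ≫ g = f := by
  rcases n with - | n
  · have h0 : ∀ g : P.complex.X ((ComplexShape.down ℕ).next 0) ⟶ Y,
        P.complex.d 0 ((ComplexShape.down ℕ).next 0) ≫ g = 0 := by
      intro g
      rw [P.complex.shape _ _ (by simp), zero_comp]
    constructor
    · intro h
      refine ⟨0, (h0 0).trans ?_⟩
      simp only [← P.extEquivCohomologyClass.apply_eq_iff_eq,
        ProjectiveResolution.extEquivCohomologyClass_extMk,
        ProjectiveResolution.extEquivCohomologyClass_zero,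
        CochainComplex.HomComplex.CohomologyClass.mk_eq_zero_iff] at h
      rw [CochainComplex.HomComplex.Cocycle.toSingleMk_mem_coboundaries_iff _ _ _ _ _ 1
        (by lia)] at h
      obtain ⟨g, hg⟩ := h
      have hz : IsZero (P.cochainComplex.X 1) :=
        P.cochainComplex.isZero_of_isStrictlyLE 0 1 (by lia)
      rw [hz.eq_of_src g 0, comp_zero] at hg
      rw [← cancel_epi (P.cochainComplexXIso (-(0 : ℕ)) 0 rfl).hom, comp_zero]
      exact hg
    · rintro ⟨g, hg⟩
      obtain rfl : f = 0 := hg.symm.trans (h0 g)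
      exact P.extMk_zero _ _
  · rw [P.extMk_eq_zero_iff f (n + 2) rfl hf n rfl, ChainComplex.next_nat_succ]

/-- The map from cocycles to Yoneda extensions. -/
noncomputable def cocyclesToExt :
    ((homComplex P Y).opcycles n).unop →ₗ[R] Abelian.Ext X Y n where
  toFun z := P.extMk (cocyclesInc P Y n z) (n + 1) rfl (d_comp_cocyclesInc P Y n z)
  map_add' z w := by
    rw [P.add_extMk]
    congr 1
    exact map_add _ z w
  map_smul' r z := by
    rw [RingHom.id_apply, Abelian.Ext.smul_eq_comp_mk₀, P.extMk_comp_mk₀]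
    congr 1
    rw [Linear.comp_smul, Category.comp_id]
    exact map_smul (cocyclesInc P Y n).hom r z

lemma cocyclesToExt_surjective : Function.Surjective (cocyclesToExt P Y n) := by
  intro y
  obtain ⟨f, hf, rfl⟩ := P.extMk_surjective y (n + 1) rfl
  obtain ⟨z, rfl⟩ := exists_cocyclesInc_eq P Y n f hf
  exact ⟨z, rfl⟩

lemma ker_cocyclesToExt :
    LinearMap.ker (cocyclesProj P Y n).hom = LinearMap.ker (cocyclesToExt P Y n) := by
  ext z
  exact (cocyclesProj_eq_zero_iff P Y n z).trans
    (extMk_eq_zero_iff P Y n _ (d_comp_cocyclesInc P Y n z)).symm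

/-- The two constructions of the `Ext`-modules agree. -/
noncomputable def extEquiv (X Y : ModuleCat.{u} R) (n : ℕ) :
    extMod R n X Y ≃ₗ[R] Abelian.Ext X Y n :=
  let P := ProjectiveResolution.of X
  ((cocyclesProj P Y n).hom.quotKerEquivOfSurjective (cocyclesProj_surjective P Y n)).symm ≪≫ₗ
    Submodule.quotEquivOfEq _ _ (ker_cocyclesToExt P Y n) ≪≫ₗ
      (cocyclesToExt P Y n).quotKerEquivOfSurjective (cocyclesToExt_surjective P Y n)

lemma extEquiv_cocyclesProj (z : ((homComplex (ProjectiveResolution.of X) Y).opcycles n).unop) :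
    extEquiv X Y n (cocyclesProj _ Y n z) = cocyclesToExt _ Y n z := by
  let P := ProjectiveResolution.of X
  have : ((cocyclesProj P Y n).hom.quotKerEquivOfSurjective
      (cocyclesProj_surjective P Y n)).symm (cocyclesProj P Y n z) = Submodule.Quotient.mk z :=
    (LinearEquiv.symm_apply_eq _).2 rfl
  simp only [extEquiv, LinearEquiv.trans_apply]
  erw [this]
  rfl

lemma extEquiv_extModMap (g : X' ⟶ X) (x : extMod R n X Y) :
    extEquiv X' Y n (extModMap n g Y x) =
      (Abelian.Ext.mk₀ g).comp (extEquiv X Y n x) (zero_add n) := by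
  obtain ⟨z, rfl⟩ := cocyclesProj_surjective (ProjectiveResolution.of X) Y n x
  let φ : ProjectiveResolution.Hom (.of X') (.of X) g :=
    ⟨ProjectiveResolution.lift g _ _, ProjectiveResolution.lift_commutes_zero g _ _⟩
  obtain ⟨z', h1, h2⟩ := extModMap_cocyclesProj Y n φ z
  rw [← h2, extEquiv_cocyclesProj, extEquiv_cocyclesProj]
  refine Eq.trans ?_ (ProjectiveResolution.mk₀_comp_extMk _ _ rfl
    (d_comp_cocyclesInc _ Y n z) φ).symm
  simp only [cocyclesToExt, LinearMap.coe_mk, AddHom.coe_mk]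
  congr 1

end ExtComparison

namespace LocalCohomologyVanishing

open Limits ExtComparison

variable {R : Type u} [CommRing R] (a : Ideal R)

/-- The module `R ⧸ a ^ t`. -/
abbrev powQuot (t : ℕ) : ModuleCat.{u} R := ModuleCat.of R (R ⧸ a ^ t)

/-- The projection `R ⧸ a ^ t' ⟶ R ⧸ a ^ t` for `t ≤ t'`. -/
noncomputable def powQuotMap {t t' : ℕ} (h : t ≤ t') : powQuot a t' ⟶ powQuot a t :=
  ModuleCat.ofHom (Submodule.mapQ _ _ LinearMap.id (Ideal.pow_le_pow_right h))

/-- The vanishing of `H^j_a(L)`, in terms of the system of modules `Ext^j(R ⧸ a ^ t, L)`. -/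
def Vanishes (j : ℕ) (L : ModuleCat.{u} R) : Prop :=
  ∀ (t : ℕ) (x : Abelian.Ext (powQuot a t) L j), ∃ (t' : ℕ) (h : t ≤ t'),
    (Abelian.Ext.mk₀ (powQuotMap a h)).comp x (zero_add j) = 0

lemma powQuotMap_comp {t t' t'' : ℕ} (h : t ≤ t') (h' : t' ≤ t'') :
    powQuotMap a h' ≫ powQuotMap a h = powQuotMap a (h.trans h') := by
  ext
  rfl

lemma subsingleton_isColimit_iff {G : ℕᵒᵖᵒᵖ ⥤ ModuleCat.{u} R} {c : Cocone G}
    (hc : IsColimit c) :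
    Subsingleton c.pt ↔ ∀ (t : ℕ) (y : G.obj (.op (.op t))), ∃ (t' : ℕ) (h : t ≤ t'),
      G.map (homOfLE h).op.op y = 0 := by
  have : PreservesFilteredColimitsOfSize.{0, 0} (forget (ModuleCat.{u} R)) :=
    preservesFilteredColimitsOfSize_shrink.{0, u, 0, u} _
  constructor
  · intro hs t y
    have h0 : c.ι.app (.op (.op t)) y = c.ι.app (.op (.op t)) 0 := hs.elim _ _
    obtain ⟨s, f, hfg⟩ := (hc.eq_iff' y 0).1 h0
    exact ⟨s.unop.unop, leOfHom f.unop.unop, hfg.trans (map_zero _)⟩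
  · intro hv
    refine subsingleton_of_forall_eq 0 fun z => ?_
    obtain ⟨s, y, rfl⟩ := Concrete.isColimit_exists_rep G hc z
    obtain ⟨t', h, ht⟩ := hv s.unop.unop y
    rw [← c.w (homOfLE h).op.op]
    exact (congrArg (c.ι.app (.op (.op t'))) ht).trans (map_zero (c.ι.app (.op (.op t'))).hom)

open localCohomology in
lemma subsingleton_localCohomology_iff (j : ℕ) (L : ModuleCat.{u} R) :
    Subsingleton ((localCohomology a j).obj L) ↔ Vanishes a j L := by
  have hF : HasColimit (diagram (idealPowersDiagram a) j) :=
    hasColimitDiagram.{u, 0} (idealPowersDiagram a) j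
  have hc := isColimitOfPreserves ((evaluation (ModuleCat.{u} R) (ModuleCat.{u} R)).obj L)
    (colimit.isColimit (diagram (idealPowersDiagram a) j))
  refine (subsingleton_isColimit_iff hc).trans ?_
  have key : ∀ (t t' : ℕ) (h : t ≤ t') (y : extMod R j (powQuot a t) L),
      extModMap j (powQuotMap a h) L y = 0 ↔
        (Abelian.Ext.mk₀ (powQuotMap a h)).comp (extEquiv _ L j y) (zero_add j) = 0 := by
    intro t t' h y
    rw [← extEquiv_extModMap, LinearEquiv.map_eq_zero_iff]
  constructor
  · intro hs t x
    obtain ⟨y, rfl⟩ := (extEquiv _ L j).surjective x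
    obtain ⟨t', h, ht⟩ := hs t y
    exact ⟨t', h, (key t t' h y).1 ht⟩
  · intro hv t y
    obtain ⟨t', h, ht⟩ := hv t (extEquiv _ L j y)
    exact ⟨t', h, (key t t' h y).2 ht⟩

end LocalCohomologyVanishing

namespace LocalCohomologyVanishing

open Limits ExtComparison

variable {R : Type u} [CommRing R] {a : Ideal R}

lemma mk₀_powQuotMap_comp_comp {t t' t'' : ℕ} (h : t ≤ t') (h' : t' ≤ t'') {L : ModuleCat.{u} R}
    {j : ℕ} (x : Abelian.Ext (powQuot a t) L j) :
    (Abelian.Ext.mk₀ (powQuotMap a h')).comp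
      ((Abelian.Ext.mk₀ (powQuotMap a h)).comp x (zero_add j)) (zero_add j) =
      (Abelian.Ext.mk₀ (powQuotMap a (h.trans h'))).comp x (zero_add j) := by
  rw [Abelian.Ext.mk₀_comp_mk₀_assoc, powQuotMap_comp]

lemma Vanishes.of_isZero {L : ModuleCat.{u} R} (hL : IsZero L) (j : ℕ) : Vanishes a j L := by
  intro t x
  refine ⟨t, le_rfl, ?_⟩
  have hx : x = 0 := by
    rw [← x.comp_mk₀_id, hL.eq_of_src (𝟙 L) 0, Abelian.Ext.mk₀_zero, Abelian.Ext.comp_zero]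
  rw [hx, Abelian.Ext.comp_zero]

lemma Vanishes.of_iso {L L' : ModuleCat.{u} R} (e : L ≅ L') {j : ℕ} (h : Vanishes a j L) :
    Vanishes a j L' := by
  intro t x
  obtain ⟨t', ht, hx⟩ := h t (x.comp (Abelian.Ext.mk₀ e.inv) (add_zero j))
  refine ⟨t', ht, ?_⟩
  have := congrArg (fun y => y.comp (Abelian.Ext.mk₀ e.hom) (add_zero j)) hx
  simpa using this

variable {S : ShortComplex (ModuleCat.{u} R)} (hS : S.ShortExact) {j : ℕ}

include hS

lemma Vanishes.of_shortExact (h₁ : Vanishes a j S.X₁) (h₃ : Vanishes a j S.X₃) :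
    Vanishes a j S.X₂ := by
  intro t x
  obtain ⟨t₁, ht₁, hx₁⟩ := h₃ t (x.comp (Abelian.Ext.mk₀ S.g) (add_zero j))
  rw [← Abelian.Ext.comp_assoc_of_third_deg_zero] at hx₁
  obtain ⟨y, hy⟩ := Abelian.Ext.covariant_sequence_exact₂ _ hS _ hx₁
  obtain ⟨t₂, ht₂, hx₂⟩ := h₁ t₁ y
  refine ⟨t₂, ht₁.trans ht₂, ?_⟩
  rw [← mk₀_powQuotMap_comp_comp ht₁ ht₂, ← hy, ← Abelian.Ext.comp_assoc_of_third_deg_zero, hx₂,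
    Abelian.Ext.zero_comp]

lemma Vanishes.X₃_of_shortExact (h₂ : Vanishes a j S.X₂) (h₁ : Vanishes a (j + 1) S.X₁) :
    Vanishes a j S.X₃ := by
  intro t x
  obtain ⟨t₁, ht₁, hx₁⟩ := h₁ t (x.comp hS.extClass rfl)
  rw [← Abelian.Ext.comp_assoc _ _ _ (zero_add j) rfl (by lia)] at hx₁
  obtain ⟨y, hy⟩ := Abelian.Ext.covariant_sequence_exact₃ _ hS _ rfl hx₁
  obtain ⟨t₂, ht₂, hx₂⟩ := h₂ t₁ y
  refine ⟨t₂, ht₁.trans ht₂, ?_⟩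
  rw [← mk₀_powQuotMap_comp_comp ht₁ ht₂, ← hy, ← Abelian.Ext.comp_assoc_of_third_deg_zero, hx₂,
    Abelian.Ext.zero_comp]

lemma Vanishes.X₁_of_shortExact (h₃ : Vanishes a j S.X₃) (h₂ : Vanishes a (j + 1) S.X₂) :
    Vanishes a (j + 1) S.X₁ := by
  intro t x
  obtain ⟨t₁, ht₁, hx₁⟩ := h₂ t (x.comp (Abelian.Ext.mk₀ S.f) (add_zero (j + 1)))
  rw [← Abelian.Ext.comp_assoc_of_third_deg_zero] at hx₁
  obtain ⟨y, hy⟩ := Abelian.Ext.covariant_sequence_exact₁ _ hS _ hx₁ rfl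
  obtain ⟨t₂, ht₂, hx₂⟩ := h₃ t₁ y
  refine ⟨t₂, ht₁.trans ht₂, ?_⟩
  rw [← mk₀_powQuotMap_comp_comp ht₁ ht₂, ← hy,
    ← Abelian.Ext.comp_assoc _ _ _ (zero_add j) rfl (by lia), hx₂, Abelian.Ext.zero_comp]

omit hS

lemma pow_smul_ext_powQuot {r : R} (hr : r ∈ a) {t : ℕ} {L : ModuleCat.{u} R}
    (x : Abelian.Ext (powQuot a t) L j) : r ^ t • x = 0 := by
  have h : r ^ t • 𝟙 (powQuot a t) = 0 := by
    ext : 1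
    refine LinearMap.ext fun y => ?_
    obtain ⟨y, rfl⟩ := Ideal.Quotient.mk_surjective y
    refine Ideal.Quotient.eq_zero_iff_mem.2 ?_
    exact Ideal.mul_mem_right _ _ (Ideal.pow_mem_pow hr t)
  rw [← x.mk₀_id_comp, ← Abelian.Ext.smul_comp, ← Abelian.Ext.mk₀_smul, h,
    Abelian.Ext.mk₀_zero, Abelian.Ext.zero_comp]

/-- If `r ∈ a` is a nonzerodivisor on `L` and `H^j_a(L/rL) = 0`, then `H^{j+1}_a(L) = 0`. -/
lemma Vanishes.of_smul_shortExact {r : R} (hr : r ∈ a) {L C : ModuleCat.{u} R} {g : L ⟶ C}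
    {w : (r • 𝟙 L) ≫ g = 0} (hS : (ShortComplex.mk (r • 𝟙 L) g w).ShortExact)
    (h : Vanishes a j C) : Vanishes a (j + 1) L := by
  have key : ∀ (s t : ℕ) (x : Abelian.Ext (powQuot a t) L (j + 1)), r ^ s • x = 0 →
      ∃ (t' : ℕ) (h : t ≤ t'),
        (Abelian.Ext.mk₀ (powQuotMap a h)).comp x (zero_add (j + 1)) = 0 := by
    intro s
    induction s with
    | zero =>
      intro t x hx
      rw [pow_zero, one_smul] at hx
      exact ⟨t, le_rfl, by rw [hx, Abelian.Ext.comp_zero]⟩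
    | succ s ih =>
      intro t x hx
      have hx' : (r ^ s • x).comp (Abelian.Ext.mk₀ (r • 𝟙 L)) (add_zero _) = 0 := by
        rw [← Abelian.Ext.smul_eq_comp_mk₀, smul_smul, ← pow_succ', hx]
      obtain ⟨z, hz⟩ := Abelian.Ext.covariant_sequence_exact₁ _ hS _ hx' rfl
      obtain ⟨t₁, ht₁, hz₁⟩ := h t z
      obtain ⟨t₂, ht₂, hx₂⟩ := ih t₁
        ((Abelian.Ext.mk₀ (powQuotMap a ht₁)).comp x (zero_add (j + 1))) (by
          rw [← Abelian.Ext.comp_smul, ← hz,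
            ← Abelian.Ext.comp_assoc _ _ _ (zero_add j) rfl (by lia), hz₁,
            Abelian.Ext.zero_comp])
      exact ⟨t₂, ht₁.trans ht₂, by rw [← mk₀_powQuotMap_comp_comp ht₁ ht₂, hx₂]⟩
  exact fun t x => key t t x (pow_smul_ext_powQuot hr x)

end LocalCohomologyVanishing

namespace LocalCohomologyVanishing

open Limits ExtComparison

section Torsion

variable {R : Type u} [CommRing R] (a : Ideal R)

lemma exists_le_torsionBySet_pow {M : Type u} [AddCommGroup M] [Module R M] {J : Submodule R M}
    (hJ : J.FG) (h : J ≤ a.primaryComponent M) :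
    ∃ n, J ≤ Submodule.torsionBySet R M (a ^ n : Ideal R) := by
  obtain ⟨s, rfl⟩ := hJ
  have h1 : ∀ x ∈ s, ∀ᶠ n in Filter.atTop, x ∈ Submodule.torsionBySet R M (a ^ n : Ideal R) := by
    intro x hx
    obtain ⟨n, hn⟩ := (a.primaryComponent_mem M x).1 (h (Submodule.subset_span hx))
    filter_upwards [Filter.eventually_ge_atTop n] with m hm
    exact Submodule.torsionBySet_le_torsionBySet_of_subset (Ideal.pow_le_pow_right hm) hn
  obtain ⟨n, hn⟩ := ((Finset.eventually_all s).2 h1).exists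
  exact ⟨n, Submodule.span_le.2 hn⟩

variable [IsNoetherianRing R]

lemma injective_primaryComponent (E : Type u) [AddCommGroup E] [Module R E] [Module.Injective R E] :
    Module.Injective R (a.primaryComponent E) := by
  refine Module.Baer.injective fun I g => ?_
  obtain ⟨n, hn⟩ := exists_le_torsionBySet_pow a
    (J := LinearMap.range ((a.primaryComponent E).subtype ∘ₗ g))
    (by rw [LinearMap.range_eq_map]; exact Submodule.FG.map _ (Module.Finite.fg_top)) (by
      rintro _ ⟨x, rfl⟩
      exact (g x).2)
  obtain ⟨k, hk⟩ := a.exists_pow_inf_eq_pow_smul (M := R) I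
  have hle : a ^ (n + k) ⊓ I ≤ a ^ n * I := by
    have := hk (n + k) (by lia)
    rw [smul_eq_mul, Ideal.mul_top, Nat.add_sub_cancel] at this
    rw [this]
    exact Ideal.mul_mono_right inf_le_right
  have hker : ∀ (x : R) (hx : x ∈ I), x ∈ a ^ n * I → g ⟨x, hx⟩ = 0 := by
    intro x hx hxa
    have h1 : ∀ y ∈ a ^ n * I, ∃ hy : y ∈ I, g ⟨y, hy⟩ = 0 := by
      intro y hy
      induction hy using Submodule.mul_induction_on' with
      | mem_mul_mem r hr s hs =>
        refine ⟨I.mul_mem_left r hs, ?_⟩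
        have h2 := hn (LinearMap.mem_range_self _ ⟨s, hs⟩)
        have h3 := (Submodule.mem_torsionBySet_iff _ _).1 h2 ⟨r, hr⟩
        refine Subtype.ext ?_
        have h4 : (⟨r * s, I.mul_mem_left r hs⟩ : I) = r • ⟨s, hs⟩ := rfl
        rw [h4, map_smul]
        exact h3
      | add y _ z _ hy hz =>
        obtain ⟨hy, hy'⟩ := hy
        obtain ⟨hz, hz'⟩ := hz
        refine ⟨I.add_mem hy hz, ?_⟩
        have h4 : (⟨y + z, I.add_mem hy hz⟩ : I) = ⟨y, hy⟩ + ⟨z, hz⟩ := rfl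
        rw [h4, map_add, hy', hz', add_zero]
    exact (h1 x hxa).2
  let ι : (I ⧸ Submodule.comap I.subtype (a ^ (n + k))) →ₗ[R] (R ⧸ a ^ (n + k)) :=
    Submodule.mapQ _ _ I.subtype le_rfl
  have hι : Function.Injective ι := by
    rw [← LinearMap.ker_eq_bot, Submodule.ker_mapQ]
    simp
  let g' : (I ⧸ Submodule.comap I.subtype (a ^ (n + k))) →ₗ[R] E :=
    Submodule.liftQ _ ((a.primaryComponent E).subtype ∘ₗ g) (by
      rintro ⟨x, hx⟩ hxa
      rw [LinearMap.mem_ker, LinearMap.comp_apply, hker x hx (hle ⟨hxa, hx⟩), map_zero])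
  obtain ⟨f, hf⟩ := Module.Injective.out ι hι g'
  have hf1 : f 1 ∈ a.primaryComponent E := by
    rw [a.primaryComponent_mem E]
    refine ⟨n + k, (Submodule.mem_torsionBySet_iff _ _).2 ?_⟩
    rintro ⟨r, hr⟩
    have : r • (1 : R ⧸ a ^ (n + k)) = 0 := by
      rw [Algebra.smul_def, mul_one]
      exact Ideal.Quotient.eq_zero_iff_mem.2 hr
    rw [← map_smul, this, map_zero]
  refine ⟨LinearMap.toSpanSingleton R _ ⟨f 1, hf1⟩, fun x hx => Subtype.ext ?_⟩
  have h5 := hf (Submodule.Quotient.mk ⟨x, hx⟩)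
  have h6 : ι (Submodule.Quotient.mk ⟨x, hx⟩) = x • (1 : R ⧸ a ^ (n + k)) := by
    rw [Algebra.smul_def, mul_one]
    rfl
  rw [h6, map_smul] at h5
  exact h5

omit [IsNoetherianRing R] in
lemma primaryComponent_eq_top_of_surjective {M M' : Type u} [AddCommGroup M] [Module R M]
    [AddCommGroup M'] [Module R M'] {f : M →ₗ[R] M'} (hf : Function.Surjective f)
    (h : a.primaryComponent M = ⊤) : a.primaryComponent M' = ⊤ := by
  refine eq_top_iff.2 fun y _ => ?_
  obtain ⟨x, rfl⟩ := hf y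
  exact a.primaryComponent_map_mem f ⟨x, h ▸ Submodule.mem_top⟩

lemma exists_shortExact_of_torsion (T : ModuleCat.{u} R) (hT : a.primaryComponent T = ⊤) :
    ∃ (G Q : ModuleCat.{u} R) (f : T ⟶ G) (g : G ⟶ Q) (w : f ≫ g = 0),
      (ShortComplex.mk f g w).ShortExact ∧ Injective G ∧ a.primaryComponent G = ⊤ ∧
        a.primaryComponent Q = ⊤ := by
  let E := Injective.under T
  have hE : Module.Injective R E := (Module.injective_iff_injective_object R E).2
    (inferInstanceAs (Injective (Injective.under T)))
  let f : T →ₗ[R] a.primaryComponent E := (Injective.ι T).hom.codRestrict _ fun x =>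
    a.primaryComponent_map_mem (Injective.ι T).hom ⟨x, hT ▸ Submodule.mem_top⟩
  have hf : Function.Injective f := by
    have := (ModuleCat.mono_iff_injective (Injective.ι T)).1 inferInstance
    exact fun x y hxy => this (congrArg Subtype.val hxy)
  have htop : a.primaryComponent (a.primaryComponent E) = ⊤ := by
    refine eq_top_iff.2 fun x _ => (a.primaryComponent_mem _ x).2 ?_
    obtain ⟨n, hn⟩ := (a.primaryComponent_mem _ _).1 x.2
    exact ⟨n, (Submodule.mem_torsionBySet_iff _ _).2 fun r => Subtype.ext
      ((Submodule.mem_torsionBySet_iff _ _).1 hn r)⟩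
  refine ⟨.of R (a.primaryComponent E), .of R (_ ⧸ LinearMap.range f), ModuleCat.ofHom f,
    ModuleCat.ofHom (LinearMap.range f).mkQ, ?_, ?_, ?_, htop, ?_⟩
  · ext x
    exact (Submodule.Quotient.mk_eq_zero _).2 ⟨x, rfl⟩
  · refine ModuleCat.shortComplex_shortExact _ ?_ hf (Submodule.mkQ_surjective _)
    exact LinearMap.exact_map_mkQ_range f
  · exact (Module.injective_iff_injective_object R _).1 (injective_primaryComponent a E)
  · exact primaryComponent_eq_top_of_surjective a (Submodule.mkQ_surjective _) htop

variable {a}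

omit [IsNoetherianRing R] in
lemma Vanishes.of_injective (j : ℕ) (G : ModuleCat.{u} R) [Injective G] :
    Vanishes a (j + 1) G :=
  fun t _ => ⟨t, le_rfl, Abelian.Ext.eq_zero_of_injective _⟩

/-- Higher local cohomology of `a`-torsion modules vanishes. -/
lemma Vanishes.of_torsion (j : ℕ) : ∀ (T : ModuleCat.{u} R), a.primaryComponent T = ⊤ →
    Vanishes a (j + 1) T := by
  induction j with
  | zero =>
    intro T hT t x
    obtain ⟨G, Q, f, g, w, hS, hG, hGt, -⟩ := exists_shortExact_of_torsion a T hT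
    obtain ⟨z, rfl⟩ := Abelian.Ext.covariant_sequence_exact₁ _ hS x
      (Abelian.Ext.eq_zero_of_injective _) rfl
    obtain ⟨z, rfl⟩ := (Abelian.Ext.mk₀_bijective _ _).2 z
    dsimp at z
    obtain ⟨e, he⟩ := hS.moduleCat_surjective_g (z.hom (Ideal.Quotient.mk _ 1))
    have hmem : e ∈ a.primaryComponent G := hGt ▸ Submodule.mem_top
    obtain ⟨n, hn⟩ := (a.primaryComponent_mem _ _).1 hmem
    have ht : t ≤ max t n := le_max_left _ _
    let v : powQuot a (max t n) ⟶ G := ModuleCat.ofHom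
      (Submodule.liftQ _ (LinearMap.toSpanSingleton R G e) fun r hr =>
        (Submodule.mem_torsionBySet_iff _ _).1 hn ⟨r, Ideal.pow_le_pow_right (le_max_right _ _) hr⟩)
    have hv : powQuotMap a ht ≫ z = v ≫ g := by
      ext : 1
      refine LinearMap.ext fun y => ?_
      obtain ⟨y, rfl⟩ := Ideal.Quotient.mk_surjective y
      have h1 : (powQuotMap a ht).hom (Ideal.Quotient.mk _ y) =
        y • (Ideal.Quotient.mk _ 1 : R ⧸ a ^ t) := by
        rw [Algebra.smul_def, map_one, mul_one]
        rfl
      have h2 : v.hom (Ideal.Quotient.mk _ y) = y • e := rfl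
      rw [ModuleCat.hom_comp, ModuleCat.hom_comp, LinearMap.comp_apply, LinearMap.comp_apply,
        h1, h2, map_smul, map_smul]
      exact congrArg _ he.symm
    refine ⟨max t n, ht, ?_⟩
    rw [← Abelian.Ext.comp_assoc _ _ _ (zero_add 0) rfl (by lia), Abelian.Ext.mk₀_comp_mk₀, hv,
      ← Abelian.Ext.mk₀_comp_mk₀, Abelian.Ext.comp_assoc_of_second_deg_zero,
      hS.comp_extClass, Abelian.Ext.comp_zero]
  | succ j ih =>
    intro T hT
    obtain ⟨G, Q, f, g, w, hS, hG, -, hQ⟩ := exists_shortExact_of_torsion a T hT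
    exact Vanishes.X₁_of_shortExact hS (ih Q hQ) (Vanishes.of_injective _ G)

end Torsion

end LocalCohomologyVanishing

namespace LocalCohomologyVanishing

open Limits ExtComparison

section Support

variable {R : Type u} [CommRing R] {a : Ideal R}

lemma mem_support_quotient_iff (I : Ideal R) (p : PrimeSpectrum R) :
    p ∈ Module.support R (R ⧸ I) ↔ I ≤ p.asIdeal := by
  rw [Module.mem_support_iff_of_finite, Ideal.annihilator_quotient]

lemma shortExact_mk_ofHom {A B C : Type u} [AddCommGroup A] [Module R A] [AddCommGroup B]
    [Module R B] [AddCommGroup C] [Module R C] {f : A →ₗ[R] B} {g : B →ₗ[R] C}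
    (hf : Function.Injective f) (hg : Function.Surjective g) (hfg : Function.Exact f g) :
    (ModuleCat.shortComplexOfCompEqZero f g hfg.linearMap_comp_eq_zero).ShortExact :=
  ModuleCat.shortComplex_shortExact _ hfg hf hg

variable [IsNoetherianRing R]

/-- Vanishing on the quotients by the primes in the support implies vanishing. -/
lemma Vanishes.of_forall_mem_support {j : ℕ} {L : Type u} [AddCommGroup L] [Module R L]
    [hL : Module.Finite R L]
    (h : ∀ q ∈ Module.support R L, Vanishes a j (.of R (R ⧸ q.asIdeal))) :
    Vanishes a j (.of R L) := by
  generalize hs : Module.support R L = s at h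
  replace hs := hs.subset
  induction hL using IsNoetherianRing.induction_on_isQuotientEquivQuotientPrime R with
  | subsingleton N => exact .of_isZero (ModuleCat.isZero_of_subsingleton _) j
  | quotient N p e =>
    have hp : p ∈ Module.support R N := by
      rw [e.support_eq, mem_support_quotient_iff]
    exact .of_iso e.symm.toModuleIso (h p (hs hp))
  | exact N₁ N₂ N₃ f g hf hg hfg ih₁ ih₃ =>
    rw [Module.support_of_exact hfg hf hg, Set.union_subset_iff] at hs
    exact .of_shortExact (shortExact_mk_ofHom hf hg hfg) (ih₁ hs.1) (ih₃ hs.2)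

omit [IsNoetherianRing R] in
lemma lt_of_mem_support_quotient {p : PrimeSpectrum R} {I : Submodule R (R ⧸ p.asIdeal)}
    (hI : I ≠ ⊥) {q : PrimeSpectrum R} (hq : q ∈ Module.support R ((R ⧸ p.asIdeal) ⧸ I)) :
    p < q := by
  obtain ⟨s, hs, hs0⟩ := (Submodule.ne_bot_iff I).1 hI
  obtain ⟨s, rfl⟩ := Ideal.Quotient.mk_surjective s
  have hann : ∀ r, (∀ y : R, Ideal.Quotient.mk p.asIdeal (r * y) ∈ I) → r ∈ q.asIdeal := by
    refine fun r hr => Module.annihilator_le_of_mem_support hq (Module.mem_annihilator.2 fun y => ?_)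
    obtain ⟨y, rfl⟩ := Submodule.mkQ_surjective _ y
    obtain ⟨y, rfl⟩ := Ideal.Quotient.mk_surjective y
    exact (Submodule.Quotient.mk_eq_zero _).2 (hr y)
  have hle : p.asIdeal ≤ q.asIdeal := by
    refine fun r hr => hann r fun y => ?_
    rw [Ideal.Quotient.eq_zero_iff_mem.2 (Ideal.mul_mem_right y _ hr)]
    exact I.zero_mem
  refine lt_of_le_of_ne hle fun hpq => hs0 (Ideal.Quotient.eq_zero_iff_mem.2 (hpq ▸ hann s ?_))
  intro y
  rw [mul_comm]
  exact I.smul_mem y hs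

lemma Vanishes.quotient_of_coheight_lt (n : ℕ) : ∀ p : PrimeSpectrum R, Order.coheight p < n →
    ∀ j, n ≤ j → Vanishes a j (.of R (R ⧸ p.asIdeal)) := by
  induction n with
  | zero =>
    intro p hp
    simp at hp
  | succ n ih =>
    intro p hp j hj
    obtain ⟨j, rfl⟩ : ∃ k, j = k + 1 := ⟨j - 1, by lia⟩
    by_cases hap : a ≤ p.asIdeal
    · refine .of_torsion j _ (eq_top_iff.2 fun y _ => (a.primaryComponent_mem _ y).2 ?_)
      refine ⟨1, (Submodule.mem_torsionBySet_iff _ _).2 ?_⟩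
      rintro ⟨r, hr⟩
      obtain ⟨y, rfl⟩ := Ideal.Quotient.mk_surjective y
      rw [pow_one] at hr
      exact Ideal.Quotient.eq_zero_iff_mem.2 (Ideal.mul_mem_right _ _ (hap hr))
    · obtain ⟨r, hr, hrp⟩ := SetLike.not_le_iff_exists.1 hap
      let f : (R ⧸ p.asIdeal) →ₗ[R] (R ⧸ p.asIdeal) := r • LinearMap.id
      have hf : Function.Injective f := by
        rw [injective_iff_map_eq_zero]
        intro y hy
        obtain ⟨y, rfl⟩ := Ideal.Quotient.mk_surjective y
        have : r * y ∈ p.asIdeal := Ideal.Quotient.eq_zero_iff_mem.1 hy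
        exact Ideal.Quotient.eq_zero_iff_mem.2 ((p.2.mem_or_mem this).resolve_left hrp)
      refine Vanishes.of_smul_shortExact hr (shortExact_mk_ofHom hf
        (Submodule.mkQ_surjective _) (LinearMap.exact_map_mkQ_range f)) ?_
      refine Vanishes.of_forall_mem_support fun q hq => ?_
      have hpq : p < q := by
        refine lt_of_mem_support_quotient (fun h => ?_) hq
        refine hrp (Ideal.Quotient.eq_zero_iff_mem.1 ((Submodule.eq_bot_iff _).1 h _ ⟨1, ?_⟩))
        exact congrArg (Ideal.Quotient.mk p.asIdeal) (mul_one r)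
      refine ih q ?_ j (by lia)
      have h1 : Order.coheight q < Order.coheight p :=
        Order.coheight_strictAnti hpq
          (lt_of_lt_of_le ((Order.coheight_anti hpq.le).trans_lt hp) le_top)
      have h2 : Order.coheight p ≤ n := by
        exact Order.le_of_lt_add_one (by exact_mod_cast hp)
      exact h1.trans_le h2

lemma exists_forall_vanishes (hfin : ringKrullDim R ≠ ⊤) (a : Ideal R) :
    ∃ d, ∀ p : PrimeSpectrum R, ∀ j, d ≤ j → Vanishes a j (.of R (R ⧸ p.asIdeal)) := by
  obtain ⟨n, hn⟩ : ∃ n : ℕ, ringKrullDim R ≤ n := by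
    generalize ringKrullDim R = k at hfin
    induction k with
    | bot => exact ⟨0, bot_le⟩
    | coe k =>
      induction k with
      | top => exact absurd rfl hfin
      | coe k => exact ⟨k, le_rfl⟩
  refine ⟨n + 1, fun p => Vanishes.quotient_of_coheight_lt (n + 1) p ?_⟩
  have h : (Order.coheight p : WithBot ℕ∞) ≤ n := (Order.coheight_le_krullDim p).trans hn
  have h' : Order.coheight p ≤ n := by exact_mod_cast h
  exact h'.trans_lt (by exact_mod_cast Nat.lt_succ_self n)

end Support

end LocalCohomologyVanishing

namespace LocalCohomologyVanishing

open Limits ExtComparison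

section Comparison

variable {R : Type u} [CommRing R]

lemma mem_support_of_linearMap_ne_zero {K : Type u} [AddCommGroup K] [Module R K]
    {p : PrimeSpectrum R} {φ : K →ₗ[R] (R ⧸ p.asIdeal)} (hφ : φ ≠ 0) :
    p ∈ Module.support R K := by
  obtain ⟨m, hm⟩ := DFunLike.exists_ne hφ
  refine Module.mem_support_iff_exists_annihilator.2 ⟨m, fun r hr => ?_⟩
  obtain ⟨s, hs⟩ := Ideal.Quotient.mk_surjective (φ m)
  rw [LinearMap.zero_apply, ← hs, Ne, Ideal.Quotient.eq_zero_iff_mem] at hm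
  have h : r • φ m = 0 := by
    rw [← map_smul, (Submodule.mem_annihilator_span_singleton m r).1 hr, map_zero]
  rw [← hs] at h
  exact (p.2.mem_or_mem (Ideal.Quotient.eq_zero_iff_mem.1 h)).resolve_right hm

lemma exists_linearMap_ne_zero {K : Type u} [AddCommGroup K] [Module R K] [Module.Finite R K]
    {p : PrimeSpectrum R} (hp : p ∈ Module.support R K) :
    ∃ φ : K →ₗ[R] (R ⧸ p.asIdeal), φ ≠ 0 := by
  rw [Module.mem_support_iff_nontrivial_residueField_tensorProduct] at hp
  obtain ⟨v, hv⟩ := exists_ne (0 : p.asIdeal.ResidueField ⊗[R] K)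
  obtain ⟨f, hf⟩ := Module.Projective.exists_dual_ne_zero p.asIdeal.ResidueField hv
  obtain ⟨k, hk⟩ : ∃ k : K, f (1 ⊗ₜ k) ≠ 0 := by
    by_contra! hk
    refine hf ?_
    induction v with
    | zero => exact map_zero f
    | add x y hx hy =>
      rw [map_add]
      by_cases h : f x = 0 <;> by_cases h' : f y = 0 <;> simp_all
    | tmul c k =>
      rw [← mul_one c, ← smul_eq_mul, ← TensorProduct.smul_tmul', map_smul, hk, smul_zero]
  let ψ : K →ₗ[R] p.asIdeal.ResidueField :=
    f.restrictScalars R ∘ₗ TensorProduct.mk R p.asIdeal.ResidueField K 1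
  let ι : (R ⧸ p.asIdeal) →ₗ[R] p.asIdeal.ResidueField :=
    (IsScalarTower.toAlgHom R (R ⧸ p.asIdeal) p.asIdeal.ResidueField).toLinearMap
  have hι : Function.Injective ι := p.asIdeal.injective_algebraMap_quotient_residueField
  classical
  obtain ⟨s, hs⟩ := Module.Finite.fg_top (R := R) (M := K)
  obtain ⟨b, hb⟩ := IsLocalization.exist_integer_multiples_of_finset
    (nonZeroDivisors (R ⧸ p.asIdeal)) (s.image ψ)
  obtain ⟨r, hr⟩ := Ideal.Quotient.mk_surjective (b : R ⧸ p.asIdeal)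
  have hrange (x : K) : (r • ψ) x ∈ LinearMap.range ι := by
    suffices (⊤ : Submodule R K) ≤ (LinearMap.range ι).comap (r • ψ) from this trivial
    rw [← hs, Submodule.span_le]
    intro x hx
    obtain ⟨y, hy⟩ := hb (ψ x) (Finset.mem_image_of_mem ψ hx)
    refine ⟨y, hy.trans ?_⟩
    rw [← hr, LinearMap.smul_apply]
    exact algebraMap_smul (R ⧸ p.asIdeal) r (ψ x)
  refine ⟨(LinearEquiv.ofInjective ι hι).symm ∘ₗ (r • ψ).codRestrict _ hrange, fun h => ?_⟩
  have h0 : r • ψ k = 0 := congr_arg Subtype.val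
    ((LinearEquiv.ofInjective ι hι).symm.map_eq_zero_iff.1 congr($h k))
  rw [← algebraMap_smul p.asIdeal.ResidueField, smul_eq_mul, mul_eq_zero,
    Ideal.algebraMap_residueField_eq_zero, ← Ideal.Quotient.eq_zero_iff_mem, hr] at h0
  exact h0.elim (nonZeroDivisors.coe_ne_zero b) hk

lemma mem_support_tensorProduct {M N : Type u} [AddCommGroup M] [Module R M] [Module.Finite R M]
    [AddCommGroup N] [Module R N] [Module.Finite R N] {p : PrimeSpectrum R}
    (hM : p ∈ Module.support R M) (hN : p ∈ Module.support R N) :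
    p ∈ Module.support R (M ⊗[R] N) := by
  obtain ⟨φ, hφ⟩ := exists_linearMap_ne_zero hM
  obtain ⟨ψ, hψ⟩ := exists_linearMap_ne_zero hN
  obtain ⟨m, hm⟩ := DFunLike.exists_ne hφ
  obtain ⟨n, hn⟩ := DFunLike.exists_ne hψ
  have : IsDomain (R ⧸ p.asIdeal) := inferInstance
  refine mem_support_of_linearMap_ne_zero
    (φ := LinearMap.mul' R (R ⧸ p.asIdeal) ∘ₗ TensorProduct.map φ ψ) fun h => ?_
  exact mul_ne_zero hm hn (congr($h (m ⊗ₜ n)))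

variable [IsNoetherianRing R] {a : Ideal R}

/-- If `H^j_a(K) = 0` for all `j ≥ J`, the same holds for `R ⧸ p` for `p` in the support
of `K`. -/
lemma Vanishes.quotient_of_mem_support (hfin : ringKrullDim R ≠ ⊤) {K : Type u} [AddCommGroup K]
    [Module R K] [Module.Finite R K] {J : ℕ} (hK : ∀ j, J ≤ j → Vanishes a j (.of R K))
    {j : ℕ} (hj : J ≤ j) {p : PrimeSpectrum R} (hp : p ∈ Module.support R K) :
    Vanishes a j (.of R (R ⧸ p.asIdeal)) := by
  obtain ⟨d, hd⟩ := exists_forall_vanishes hfin a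
  suffices H : ∀ k j, J ≤ j → d ≤ j + k → ∀ p ∈ Module.support R K,
      Vanishes a j (.of R (R ⧸ p.asIdeal)) from H d j hj (by lia) p hp
  have : WellFoundedGT (PrimeSpectrum R) :=
    StrictMono.wellFoundedGT (f := PrimeSpectrum.asIdeal) fun _ _ h => h
  intro k
  induction k with
  | zero => exact fun j _ hdj p _ => hd p j hdj
  | succ k ih =>
    intro j hj hdj p
    induction p using WellFoundedGT.induction with
    | ind p ihp =>
      intro hp
      obtain ⟨φ, hφ⟩ := exists_linearMap_ne_zero hp
      have hker : Vanishes a (j + 1) (.of R (LinearMap.ker φ)) :=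
        .of_forall_mem_support fun q hq => ih (j + 1) (by lia) (by lia) q
          (Module.support_subset_of_injective _ (LinearMap.ker φ).injective_subtype hq)
      have hrange : Vanishes a j (.of R (LinearMap.range φ)) :=
        .X₃_of_shortExact (shortExact_mk_ofHom (LinearMap.ker φ).injective_subtype
          φ.surjective_rangeRestrict (by
            rw [LinearMap.exact_iff, Submodule.range_subtype, LinearMap.ker_rangeRestrict]))
          (hK j hj) hker
      refine .of_shortExact (shortExact_mk_ofHom (LinearMap.range φ).injective_subtype
        (LinearMap.range φ).mkQ_surjective (LinearMap.exact_subtype_mkQ _)) hrange ?_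
      refine .of_forall_mem_support fun q hq => ?_
      have hpq := lt_of_mem_support_quotient (mt LinearMap.range_eq_bot.1 hφ) hq
      exact ihp q hpq (Module.mem_support_mono hpq.le hp)

end Comparison

end LocalCohomologyVanishing

namespace LocalCohomologyVanishing

open Limits ExtComparison

section Ext

variable {R : Type u} [CommRing R]

lemma annihilator_le_annihilator_ext_left (M N : ModuleCat.{u} R) (i : ℕ) :
    Module.annihilator R M ≤ Module.annihilator R (Abelian.Ext M N i) := by
  intro r hr
  have h : r • 𝟙 M = 0 := by
    ext m
    exact Module.mem_annihilator.1 hr m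
  refine Module.mem_annihilator.2 fun x => ?_
  rw [← x.mk₀_id_comp, ← Abelian.Ext.smul_comp, ← Abelian.Ext.mk₀_smul, h,
    Abelian.Ext.mk₀_zero, Abelian.Ext.zero_comp]

lemma annihilator_le_annihilator_ext_right (M N : ModuleCat.{u} R) (i : ℕ) :
    Module.annihilator R N ≤ Module.annihilator R (Abelian.Ext M N i) := by
  intro r hr
  have h : r • 𝟙 N = 0 := by
    ext m
    exact Module.mem_annihilator.1 hr m
  refine Module.mem_annihilator.2 fun x => ?_
  rw [Abelian.Ext.smul_eq_comp_mk₀, h, Abelian.Ext.mk₀_zero, Abelian.Ext.comp_zero]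

lemma support_extMod_subset_support_tensorProduct (M N : ModuleCat.{u} R) [Module.Finite R M]
    [Module.Finite R N] (i : ℕ) :
    Module.support R (extMod R i M N) ⊆ Module.support R (M ⊗[R] N) := by
  intro p hp
  rw [(extEquiv M N i).support_eq] at hp
  have h := Module.annihilator_le_of_mem_support hp
  exact mem_support_tensorProduct
    (Module.mem_support_iff_of_finite.2 ((annihilator_le_annihilator_ext_left M N i).trans h))
    (Module.mem_support_iff_of_finite.2 ((annihilator_le_annihilator_ext_right M N i).trans h))

lemma subsingleton_extMod_of_projDimLE {M : ModuleCat.{u} R} {n : ℕ} (hM : projDimLE R M n)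
    {i : ℕ} (hi : n < i) (N : ModuleCat.{u} R) : Subsingleton (extMod R i M N) := by
  have : HasProjectiveDimensionLT M (n + 1) :=
    hasProjectiveDimensionLT_of_enoughInjectives M (n + 1) fun Y =>
      haveI := hM Y
      (extEquiv M Y (n + 1)).symm.subsingleton
  have : Subsingleton (Abelian.Ext M N i) :=
    HasProjectiveDimensionLT.subsingleton M (n + 1) i hi N
  exact (extEquiv M N i).subsingleton

lemma le_projDim_of_not_subsingleton {M N : ModuleCat.{u} R} {i : ℕ}
    (h : ¬ Subsingleton (extMod R i M N)) : (i : WithBot ℕ∞) ≤ projDim R M := by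
  refine le_sInf ?_
  rintro _ ⟨n, rfl, hn⟩
  by_contra! hni
  exact h (subsingleton_extMod_of_projDimLE hn (by exact_mod_cast hni) N)

lemma vanishes_of_cohDim_lt {a : Ideal R} {K : ModuleCat.{u} R} {j : ℕ} [IsNoetherianRing R]
    (h : cohDim R a K < j) : Vanishes a j K := by
  rw [← subsingleton_localCohomology_iff]
  by_contra hj
  exact h.not_ge (le_iSup₂ (f := fun (i : ℕ)
    (_ : i ∈ {i : ℕ | ¬ Subsingleton ((localCohomology a i).obj K)}) => (i : WithBot ℕ∞)) j hj)

end Ext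

end LocalCohomologyVanishing

open LocalCohomologyVanishing ExtComparison in
/-- Theorem 3.2(ii), module case: over a commutative Noetherian ring `R` of finite
Krull dimension, if `M`, `N` are finitely generated and `M` has finite projective
dimension, then `H^j_a(Ext^i_R(M, N)) ≠ 0` implies
`i + j ≤ cd(a, M ⊗_R N) + proj.dim_R M`. -/
theorem add_le_cohDim_tensor_add_projDim_of_localCohomology_ext_ne_zero (R : Type u)
    [CommRing R] [IsNoetherianRing R] (hfin : ringKrullDim R ≠ ⊤) (a : Ideal R)
    (M N : ModuleCat.{u} R) [Module.Finite R M] [Module.Finite R N]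
    (hpd : ∃ n : ℕ, projDimLE R M n) (i j : ℕ)
    (h : ¬ Subsingleton ((localCohomology a j).obj (extMod R i M N))) :
    ((i + j : ℕ) : WithBot ℕ∞)
      ≤ cohDim R a (ModuleCat.of R (M ⊗[R] N)) + projDim R M := by
  rw [subsingleton_localCohomology_iff] at h
  have hi : (i : WithBot ℕ∞) ≤ projDim R M := le_projDim_of_not_subsingleton (N := N) fun _ =>
    h (.of_isZero (ModuleCat.isZero_of_subsingleton _) j)
  have hj : (j : WithBot ℕ∞) ≤ cohDim R a (ModuleCat.of R (M ⊗[R] N)) := by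
    by_contra! hlt
    have : Module.Finite R (extMod R i M N) :=
      Module.Finite.equiv (extEquiv M N i).symm
    have hL : Vanishes a j (.of R (extMod R i M N)) :=
      .of_forall_mem_support fun q hq => .quotient_of_mem_support hfin (J := j)
        (fun k hk => vanishes_of_cohDim_lt (hlt.trans_le (by exact_mod_cast hk))) le_rfl
        (support_extMod_subset_support_tensorProduct M N i hq)
    exact h hL
  rw [add_comm i j, Nat.cast_add]
  exact add_le_add hj hi
end

section
/- Let R be a commutative Noetherian ring of finite Krull dimension, let a be an ideal of R, and let M and N be finitely generated R-modules with M of finite projective dimension and Supp_R N ⊆ Supp_R M. Then cd(a,N) ≤ cd(a, M ⊗_R N) + proj.dim_R M. (Module case of Theorem 3.3(i): -inf RΓ_a(Y) ≤ -inf RΓ_a(X ⊗^L_R Y) + proj.dim X when Supp Y ⊆ Supp X.) -/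
/-!
Common definitions: Ext modules, dimension of a module (Krull dimension of its
support, in `WithBot ℕ∞`, with `⊥` for the zero module), projective/injective
dimension via the Ext-vanishing characterization, and cohomological dimension
with respect to an ideal via local cohomology.
-/

open CategoryTheory TensorProduct

universe u

section LocalCohomologyVanishing

open Abelian

variable {R : Type u} [CommRing R] (a : Ideal R)

/-- The canonical surjection `R ⧸ a ^ s ⟶ R ⧸ a ^ t` for `t ≤ s`. -/
def quotPowMap {t s : ℕ} (h : t ≤ s) :
    ModuleCat.of R (R ⧸ a ^ s) ⟶ ModuleCat.of R (R ⧸ a ^ t) :=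
  ModuleCat.ofHom <| Submodule.mapQ _ _ LinearMap.id (Ideal.pow_le_pow_right h)

lemma quotPowMap_comp {t s r : ℕ} (h : t ≤ s) (h' : s ≤ r) :
    quotPowMap a h' ≫ quotPowMap a h = quotPowMap a (h.trans h') := by
  ext
  rfl

/-- Every class in `Ext^i(R ⧸ a ^ t, N)` dies in `Ext^i(R ⧸ a ^ s, N)` for some `s ≥ t`; this is
the vanishing of `colim_t Ext^i(R ⧸ a ^ t, N)`. -/
def ExtPowVanishes (i : ℕ) (N : ModuleCat.{u} R) : Prop :=
  ∀ (t : ℕ) (e : Abelian.Ext (ModuleCat.of R (R ⧸ a ^ t)) N i),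
    ∃ (s : ℕ) (h : t ≤ s), (Ext.mk₀ (quotPowMap a h)).comp e (zero_add i) = 0

variable {a}

lemma mk₀_quotPowMap_comp_assoc {N : ModuleCat.{u} R} {i t s r : ℕ} (h : t ≤ s) (h' : s ≤ r)
    (e : Abelian.Ext (ModuleCat.of R (R ⧸ a ^ t)) N i) :
    (Ext.mk₀ (quotPowMap a h')).comp ((Ext.mk₀ (quotPowMap a h)).comp e (zero_add i))
      (zero_add i) = (Ext.mk₀ (quotPowMap a (h.trans h'))).comp e (zero_add i) := by
  rw [Ext.mk₀_comp_mk₀_assoc, quotPowMap_comp]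

lemma extPowVanishes_of_subsingleton (i : ℕ) (N : ModuleCat.{u} R) [Subsingleton N] :
    ExtPowVanishes a i N := fun t e ↦ by
  have : 𝟙 N = 0 := (ModuleCat.isZero_of_subsingleton N).eq_of_src _ _
  refine ⟨t, le_rfl, ?_⟩
  rw [← Ext.comp_mk₀_id e, this, Ext.mk₀_zero, Ext.comp_zero, Ext.comp_zero]

lemma ExtPowVanishes.of_shortExact {S : ShortComplex (ModuleCat.{u} R)} (hS : S.ShortExact)
    {i : ℕ} (h₁ : ExtPowVanishes a i S.X₁) (h₃ : ExtPowVanishes a i S.X₃) :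
    ExtPowVanishes a i S.X₂ := fun t e ↦ by
  obtain ⟨s, hs, h⟩ := h₃ t (e.comp (Ext.mk₀ S.g) (add_zero i))
  rw [← Ext.comp_assoc_of_third_deg_zero] at h
  obtain ⟨e₁, he₁⟩ := Ext.covariant_sequence_exact₂ _ hS _ h
  obtain ⟨r, hr, h'⟩ := h₁ s e₁
  refine ⟨r, hs.trans hr, ?_⟩
  rw [← mk₀_quotPowMap_comp_assoc hs hr, ← he₁, ← Ext.comp_assoc_of_third_deg_zero, h',
    Ext.zero_comp]

lemma ExtPowVanishes.of_shortExact_right {S : ShortComplex (ModuleCat.{u} R)}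
    (hS : S.ShortExact) {i : ℕ} (h₁ : ExtPowVanishes a (i + 1) S.X₁)
    (h₂ : ExtPowVanishes a i S.X₂) : ExtPowVanishes a i S.X₃ := fun t e ↦ by
  obtain ⟨s, hs, h⟩ := h₁ t (e.comp hS.extClass rfl)
  rw [← Ext.comp_assoc (a₁₂ := i) _ _ _ (by lia) (by lia) (by lia)] at h
  obtain ⟨e₂, he₂⟩ := Ext.covariant_sequence_exact₃ _ hS _ _ h
  obtain ⟨r, hr, h'⟩ := h₂ s e₂
  refine ⟨r, hs.trans hr, ?_⟩
  rw [← mk₀_quotPowMap_comp_assoc hs hr, ← he₂, ← Ext.comp_assoc_of_third_deg_zero, h',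
    Ext.zero_comp]

lemma ExtPowVanishes.of_iso {M N : ModuleCat.{u} R} (f : M ≅ N) {i : ℕ}
    (h : ExtPowVanishes a i M) : ExtPowVanishes a i N := fun t e ↦ by
  obtain ⟨s, hs, h⟩ := h t (e.comp (Ext.mk₀ f.inv) (add_zero i))
  refine ⟨s, hs, ?_⟩
  have := congr(Ext.comp $h (Ext.mk₀ f.hom) (add_zero i))
  simpa [Ext.comp_assoc_of_third_deg_zero] using this

/-- Multiplication by an element of `a ^ t` kills `Ext(R ⧸ a ^ t, N)`. -/
lemma smul_ext_quotient_eq_zero {N : ModuleCat.{u} R} {i t : ℕ} {x : R} (hx : x ∈ a ^ t)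
    (e : Abelian.Ext (ModuleCat.of R (R ⧸ a ^ t)) N i) : x • e = 0 := by
  have : x • 𝟙 (ModuleCat.of R (R ⧸ a ^ t)) = 0 := by
    refine ModuleCat.hom_ext (LinearMap.ext fun y ↦ ?_)
    obtain ⟨y, rfl⟩ := Ideal.Quotient.mk_surjective y
    change x • Ideal.Quotient.mk (a ^ t) y = 0
    rw [Algebra.smul_def, Ideal.Quotient.algebraMap_eq, ← map_mul, Ideal.Quotient.eq_zero_iff_mem]
    exact Ideal.mul_mem_right _ _ hx
  rw [← Ext.mk₀_id_comp e, ← Ext.smul_comp, ← Ext.mk₀_smul, this, Ext.mk₀_zero, Ext.zero_comp]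

lemma ExtPowVanishes.exists_of_comp_eq_zero {S : ShortComplex (ModuleCat.{u} R)}
    (hS : S.ShortExact) {i : ℕ} (h₃ : ExtPowVanishes a i S.X₃) {t : ℕ}
    (e : Abelian.Ext (ModuleCat.of R (R ⧸ a ^ t)) S.X₁ (i + 1))
    (he : e.comp (Ext.mk₀ S.f) (add_zero _) = 0) :
    ∃ (s : ℕ) (h : t ≤ s), (Ext.mk₀ (quotPowMap a h)).comp e (zero_add _) = 0 := by
  obtain ⟨g, rfl⟩ := Ext.covariant_sequence_exact₁ _ hS e he rfl
  obtain ⟨s, hs, h⟩ := h₃ t g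
  refine ⟨s, hs, ?_⟩
  rw [← Ext.comp_assoc (a₁₂ := i) _ _ _ (by lia) (by lia) (by lia), h, Ext.zero_comp]

lemma ExtPowVanishes.of_isSMulRegular {N : ModuleCat.{u} R} {x : R} (hx : x ∈ a)
    (hN : IsSMulRegular N x) {i : ℕ}
    (h : ∀ t : ℕ, ExtPowVanishes a i (ModuleCat.of R (QuotSMulTop (x ^ t) N))) :
    ExtPowVanishes a (i + 1) N := fun t e ↦ by
  refine ExtPowVanishes.exists_of_comp_eq_zero (hN.pow t).smulShortComplex_shortExact (h t) e ?_
  exact (Ext.smul_eq_comp_mk₀ e (x ^ t)).symm.trans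
    (smul_ext_quotient_eq_zero (Ideal.pow_mem_pow hx t) e)

lemma exists_dimension_shift {S : ShortComplex (ModuleCat.{u} R)} (hS : S.ShortExact)
    [Projective S.X₂] {T : ModuleCat.{u} R} {j : ℕ} (e : Abelian.Ext S.X₃ T (j + 1)) :
    ∃ e' : Abelian.Ext S.X₁ T j, ∀ {S' : ShortComplex (ModuleCat.{u} R)} (_ : S'.ShortExact)
      (τ : S' ⟶ S), (Ext.mk₀ τ.τ₁).comp e' (zero_add j) = 0 →
        (Ext.mk₀ τ.τ₃).comp e (zero_add (j + 1)) = 0 := by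
  obtain ⟨e', rfl⟩ := Ext.contravariant_sequence_exact₃ hS T e
    (Ext.eq_zero_of_projective _) (add_comm 1 j)
  refine ⟨e', fun hS' τ h ↦ ?_⟩
  rw [← Ext.comp_assoc (a₁₂ := 1) _ _ _ (by lia) (by lia) (by lia),
    ← ShortComplex.ShortExact.extClass_naturality hS' hS τ,
    Ext.comp_assoc (a₂₃ := j) _ _ _ (by lia) (by lia) (by lia), h, Ext.comp_zero]

/-- The short complex of the kernel of a linear map. -/
def kerComplex {M N : Type u} [AddCommGroup M] [Module R M] [AddCommGroup N] [Module R N]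
    (f : M →ₗ[R] N) : ShortComplex (ModuleCat.{u} R) :=
  .mk (ModuleCat.ofHom (LinearMap.ker f).subtype) (ModuleCat.ofHom f) (by ext; simp)

lemma kerComplex_shortExact {M N : Type u} [AddCommGroup M] [Module R M] [AddCommGroup N]
    [Module R N] {f : M →ₗ[R] N} (hf : Function.Surjective f) : (kerComplex f).ShortExact where
  exact := by
    rw [ShortComplex.moduleCat_exact_iff]
    exact fun x hx ↦ ⟨⟨x, hx⟩, rfl⟩
  mono_f := by
    rw [ModuleCat.mono_iff_injective]
    exact Subtype.val_injective
  epi_g := by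
    rw [ModuleCat.epi_iff_surjective]
    exact hf

lemma exists_comp_eq_zero_of_ker [IsNoetherianRing R] {F A : Type u} [AddCommGroup F] [Module R F]
    [Module.Finite R F] [Module.Projective R F] [AddCommGroup A] [Module R A] {π : F →ₗ[R] A}
    (hπ : Function.Surjective π) {T : ModuleCat.{u} R} {j : ℕ}
    (hK : ∀ e : Abelian.Ext (ModuleCat.of R (LinearMap.ker π)) T j, ∃ s : ℕ,
      (Ext.mk₀ (ModuleCat.ofHom (a ^ s • ⊤ : Submodule R (LinearMap.ker π)).subtype)).comp e
        (zero_add j) = 0)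
    (e : Abelian.Ext (ModuleCat.of R A) T (j + 1)) :
    ∃ n : ℕ, ∀ {F' A' : Type u} [AddCommGroup F'] [Module R F'] [AddCommGroup A'] [Module R A']
      (π' : F' →ₗ[R] A') (_ : Function.Surjective π') (φ : F' →ₗ[R] F) (ψ : A' →ₗ[R] A),
      π ∘ₗ φ = ψ ∘ₗ π' → (∀ x ∈ LinearMap.ker π', φ x ∈ (a ^ n • ⊤ : Submodule R F)) →
        (Ext.mk₀ (ModuleCat.ofHom ψ)).comp e (zero_add (j + 1)) = 0 := by
  have hS := kerComplex_shortExact hπ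
  have : Projective (kerComplex π).X₂ := ModuleCat.projective_of_categoryTheory_projective (.of R F)
  obtain ⟨e', he'⟩ := exists_dimension_shift hS e
  obtain ⟨s, hs⟩ := hK e'
  obtain ⟨k, hk⟩ := Ideal.exists_pow_inf_eq_pow_smul a (LinearMap.ker π)
  refine ⟨k + s, fun π' hπ' φ ψ hcomm hφ ↦ ?_⟩
  have hker (x) (hx : x ∈ LinearMap.ker π') : φ x ∈ LinearMap.ker π := by
    have := LinearMap.congr_fun hcomm x
    rw [LinearMap.mem_ker] at hx ⊢
    exact this.trans (by simp [hx])
  let γ : LinearMap.ker π' →ₗ[R] LinearMap.ker π := φ.restrict hker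
  have hγ (x) : γ x ∈ (a ^ s • ⊤ : Submodule R (LinearMap.ker π)) := by
    have h₁ : φ x ∈ (a ^ (k + s) • ⊤ ⊓ LinearMap.ker π : Submodule R F) :=
      ⟨hφ x x.2, hker x x.2⟩
    rw [hk _ (Nat.le_add_right k s), Nat.add_sub_cancel_left] at h₁
    have h₂ : φ x ∈ Submodule.map (LinearMap.ker π).subtype (a ^ s • ⊤) := by
      rw [Submodule.map_smul'', Submodule.map_top, Submodule.range_subtype]
      exact Submodule.smul_mono le_rfl inf_le_right h₁
    obtain ⟨y, hy, hxy⟩ := h₂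
    rwa [show γ x = y from Subtype.ext hxy.symm]
  refine he' (kerComplex_shortExact hπ')
    { τ₁ := ModuleCat.ofHom γ
      τ₂ := ModuleCat.ofHom φ
      τ₃ := ModuleCat.ofHom ψ
      comm₁₂ := rfl
      comm₂₃ := ModuleCat.hom_ext hcomm } ?_
  have hcomp (c : Abelian.Ext (ModuleCat.of R (LinearMap.ker π)) T j)
      (hc : (Ext.mk₀ (ModuleCat.ofHom
        (a ^ s • ⊤ : Submodule R (LinearMap.ker π)).subtype)).comp c (zero_add j) = 0) :
      (Ext.mk₀ (ModuleCat.ofHom γ)).comp c (zero_add j) = 0 := by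
    have : ModuleCat.ofHom γ = ModuleCat.ofHom (γ.codRestrict _ hγ) ≫
      ModuleCat.ofHom (a ^ s • ⊤ : Submodule R (LinearMap.ker π)).subtype := rfl
    rw [this, ← Ext.mk₀_comp_mk₀_assoc, hc, Ext.comp_zero]
  exact hcomp e' hs

/-- If `a` annihilates `T`, a class in `Ext(A, T)` restricts to zero on `a ^ s • A` for large
`s`. -/
lemma exists_restrict_smul_top_eq_zero [IsNoetherianRing R] {T : ModuleCat.{u} R}
    (hT : ∀ r ∈ a, ∀ m : T, r • m = 0) (j : ℕ) :
    ∀ (A : Type u) [AddCommGroup A] [Module R A] [Module.Finite R A]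
      (e : Abelian.Ext (ModuleCat.of R A) T j), ∃ s : ℕ,
        (Ext.mk₀ (ModuleCat.ofHom (a ^ s • ⊤ : Submodule R A).subtype)).comp e
          (zero_add j) = 0 := by
  induction j with
  | zero =>
    intro A _ _ _ e
    obtain ⟨f, rfl⟩ := Ext.addEquiv₀.symm.surjective e
    refine ⟨1, ?_⟩
    have : ModuleCat.ofHom (a ^ 1 • ⊤ : Submodule R A).subtype ≫ f = 0 := by
      ext ⟨x, hx⟩
      change f.hom x = 0
      rw [pow_one] at hx
      refine Submodule.smul_induction_on hx (fun r hr m _ ↦ ?_) (fun x y hx hy ↦ ?_)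
      · rw [map_smul]
        exact hT r hr _
      · rw [map_add, hx, hy, add_zero]
    simp [this]
  | succ j ih =>
    intro A _ _ _ e
    obtain ⟨n, π, hπ⟩ := Module.Finite.exists_fin' R A
    obtain ⟨m, hm⟩ := exists_comp_eq_zero_of_ker hπ (ih (LinearMap.ker π)) e
    have hmem (x) (hx : x ∈ (a ^ m • ⊤ : Submodule R (Fin n → R))) :
        π x ∈ (a ^ m • ⊤ : Submodule R A) := by
      have := Submodule.mem_map_of_mem (f := π) hx
      rw [Submodule.map_smul''] at this
      exact Submodule.smul_mono le_rfl le_top this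
    refine ⟨m, hm (π.restrict hmem) ?_ (Submodule.subtype _) _ rfl fun x _ ↦ x.2⟩
    rintro ⟨y, hy⟩
    rw [← LinearMap.range_eq_top.mpr hπ, ← Submodule.map_top, ← Submodule.map_smul''] at hy
    obtain ⟨x, hx, rfl⟩ := hy
    exact ⟨⟨x, hx⟩, rfl⟩

lemma extPowVanishes_succ_of_smul_eq_zero [IsNoetherianRing R] {T : ModuleCat.{u} R}
    (hT : ∀ r ∈ a, ∀ m : T, r • m = 0) (j : ℕ) : ExtPowVanishes a (j + 1) T := fun t e ↦ by
  obtain ⟨n, hn⟩ := exists_comp_eq_zero_of_ker (Submodule.mkQ_surjective (a ^ t))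
    (exists_restrict_smul_top_eq_zero hT j _) e
  refine ⟨max n t, le_max_right _ _, hn (Submodule.mkQ (a ^ max n t))
    (Submodule.mkQ_surjective _) LinearMap.id _ rfl fun x hx ↦ ?_⟩
  rw [Submodule.ker_mkQ] at hx
  simpa using Ideal.pow_le_pow_right (le_max_left n t) hx

lemma ExtPowVanishes.of_linearEquiv {M N : Type u} [AddCommGroup M] [Module R M] [AddCommGroup N]
    [Module R N] (f : M ≃ₗ[R] N) {i : ℕ} (h : ExtPowVanishes a i (.of R M)) :
    ExtPowVanishes a i (.of R N) :=
  h.of_iso f.toModuleIso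

lemma ExtPowVanishes.of_exact {N₁ N₂ N₃ : Type u} [AddCommGroup N₁] [Module R N₁] [AddCommGroup N₂]
    [Module R N₂] [AddCommGroup N₃] [Module R N₃] {f : N₁ →ₗ[R] N₂} {g : N₂ →ₗ[R] N₃}
    (hf : Function.Injective f) (hg : Function.Surjective g) (hfg : Function.Exact f g) {i : ℕ}
    (h₁ : ExtPowVanishes a i (.of R N₁)) (h₃ : ExtPowVanishes a i (.of R N₃)) :
    ExtPowVanishes a i (.of R N₂) :=
  of_shortExact (S := .mk (ModuleCat.ofHom f) (ModuleCat.ofHom g)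
      (ModuleCat.hom_ext hfg.linearMap_comp_eq_zero))
    { exact := ModuleCat.shortComplex_exact _ hfg
      mono_f := (ModuleCat.mono_iff_injective _).mpr hf
      epi_g := (ModuleCat.epi_iff_surjective _).mpr hg } h₁ h₃

lemma support_quotient_ideal (I : Ideal R) :
    Module.support R (R ⧸ I) = PrimeSpectrum.zeroLocus I := by
  rw [Module.support_eq_zeroLocus, Ideal.annihilator_quotient]

/-- Dévissage: it suffices to check vanishing on the modules `R ⧸ q` with `q` in the support. -/
lemma ExtPowVanishes.of_forall_mem_support [IsNoetherianRing R] {i : ℕ} (N : Type u)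
    [AddCommGroup N] [Module R N] [hN : Module.Finite R N]
    (h : ∀ q ∈ Module.support R N, ExtPowVanishes a i (.of R (R ⧸ q.asIdeal))) :
    ExtPowVanishes a i (.of R N) := by
  revert h
  induction hN using IsNoetherianRing.induction_on_isQuotientEquivQuotientPrime R with
  | subsingleton N => exact fun _ ↦ extPowVanishes_of_subsingleton i _
  | quotient N p f =>
    refine fun h ↦ of_linearEquiv f.symm (h p ?_)
    rw [f.support_eq, support_quotient_ideal]
    exact le_refl p.asIdeal
  | exact N₁ N₂ N₃ f g hf hg hfg h₁ h₃ =>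
    intro h
    rw [Module.support_of_exact hfg hf hg] at h
    exact of_exact hf hg hfg (h₁ fun q hq ↦ h q (.inl hq)) (h₃ fun q hq ↦ h q (.inr hq))

/-- Grothendieck's vanishing theorem. -/
lemma extPowVanishes_of_coheight_lt [IsNoetherianRing R] (n : ℕ) :
    ∀ (i : ℕ) (_ : n ≤ i) (N : Type u) [AddCommGroup N] [Module R N] [Module.Finite R N],
      (∀ q ∈ Module.support R N, Order.coheight q < n) → ExtPowVanishes a i (.of R N) := by
  induction n with
  | zero =>
    intro i _ N _ _ _ h
    have : Subsingleton N := by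
      rw [← Module.support_eq_empty_iff (R := R), Set.eq_empty_iff_forall_notMem]
      exact fun q hq ↦ by simpa using h q hq
    exact extPowVanishes_of_subsingleton i _
  | succ n ih =>
    intro i hi N _ _ _ h
    obtain ⟨i, rfl⟩ := Nat.exists_eq_add_of_lt hi
    refine .of_forall_mem_support _ fun p hp ↦ ?_
    by_cases hap : a ≤ p.asIdeal
    · refine extPowVanishes_succ_of_smul_eq_zero (fun r hr m ↦ ?_) _
      obtain ⟨m, rfl⟩ := Ideal.Quotient.mk_surjective m
      change Ideal.Quotient.mk p.asIdeal (r * m) = 0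
      rw [Ideal.Quotient.eq_zero_iff_mem]
      exact Ideal.mul_mem_right _ _ (hap hr)
    · obtain ⟨x, hxa, hxp⟩ := SetLike.not_le_iff_exists.mp hap
      have hreg : IsSMulRegular (R ⧸ p.asIdeal) x :=
        IsSMulRegular.of_right_eq_zero_of_smul fun y hy ↦ by
          obtain ⟨y, rfl⟩ := Ideal.Quotient.mk_surjective y
          change Ideal.Quotient.mk p.asIdeal (x * y) = 0 at hy
          rw [Ideal.Quotient.eq_zero_iff_mem] at hy ⊢
          exact (p.2.mem_or_mem hy).resolve_left hxp
      refine ExtPowVanishes.of_isSMulRegular hxa hreg fun t ↦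
        ih _ (by lia) (QuotSMulTop (x ^ t) (R ⧸ p.asIdeal)) fun q hq ↦ ?_
      rw [Module.support_quotSMulTop, support_quotient_ideal] at hq
      have hpq : p < q := lt_of_le_of_ne hq.1 fun h ↦
        hxp (h ▸ q.2.mem_of_pow_mem t (hq.2 rfl))
      have h₁ : Order.coheight q + 1 ≤ Order.coheight p := Order.coheight_add_one_le hpq
      have h₂ := h₁.trans_lt (h p hp)
      push_cast at h₂
      exact lt_of_add_lt_add_right h₂

instance isLocalizedModule_quotient_residueField (p : Ideal R) [p.IsPrime] :
    IsLocalizedModule p.primeCompl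
      (IsScalarTower.toAlgHom R (R ⧸ p) p.ResidueField).toLinearMap where
  map_units s := by
    rw [Module.End.isUnit_iff]
    have hs : algebraMap R p.ResidueField s ≠ 0 :=
      fun h ↦ s.2 (Ideal.algebraMap_residueField_eq_zero.mp h)
    refine ⟨fun x y hxy ↦ ?_, fun x ↦ ⟨(algebraMap R p.ResidueField s)⁻¹ * x, ?_⟩⟩
    · rw [Module.algebraMap_end_apply, Module.algebraMap_end_apply, Algebra.smul_def,
        Algebra.smul_def] at hxy
      exact mul_left_cancel₀ hs hxy
    · rw [Module.algebraMap_end_apply, Algebra.smul_def, mul_inv_cancel_left₀ hs]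
  surj y := by
    obtain ⟨x, ⟨s, hs⟩, rfl⟩ := IsLocalization.exists_mk'_eq (nonZeroDivisors (R ⧸ p)) y
    obtain ⟨s, rfl⟩ := Ideal.Quotient.mk_surjective s
    refine ⟨⟨x, ⟨s, fun h ↦ nonZeroDivisors.ne_zero hs (Ideal.Quotient.eq_zero_iff_mem.mpr h)⟩⟩, ?_⟩
    rw [Submonoid.smul_def, Algebra.smul_def]
    exact IsLocalization.mk'_spec' p.ResidueField x ⟨_, hs⟩
  exists_of_eq h := ⟨1, by rw [p.injective_algebraMap_quotient_residueField h]⟩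

lemma exists_linearMap_quotient_ne_zero [IsNoetherianRing R] {L : Type u} [AddCommGroup L]
    [Module R L] [Module.Finite R L] {p : PrimeSpectrum R} (hp : p ∈ Module.support R L) :
    ∃ φ : L →ₗ[R] R ⧸ p.asIdeal, φ ≠ 0 := by
  rw [Module.mem_support_iff_nontrivial_residueField_tensorProduct] at hp
  obtain ⟨v, hv⟩ := exists_ne (0 : p.asIdeal.ResidueField ⊗[R] L)
  obtain ⟨f, hf⟩ := Module.Projective.exists_dual_ne_zero p.asIdeal.ResidueField hv
  let g : L →ₗ[R] p.asIdeal.ResidueField :=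
    f.restrictScalars R ∘ₗ TensorProduct.mk R p.asIdeal.ResidueField L 1
  have hg : ∃ x, g x ≠ 0 := by
    by_contra! hg
    refine hf (LinearMap.congr_fun (?_ : f = 0) v)
    ext x
    exact hg x
  have : Module.FinitePresentation R L := Module.finitePresentation_of_finite R L
  obtain ⟨φ, s, hφ⟩ := Module.FinitePresentation.exists_lift_of_isLocalizedModule
    p.asIdeal.primeCompl
    (IsScalarTower.toAlgHom R (R ⧸ p.asIdeal) p.asIdeal.ResidueField).toLinearMap g
  obtain ⟨x, hx⟩ := hg
  refine ⟨φ, fun h ↦ ?_⟩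
  have hsx : s • g x = 0 := by simpa [h] using (LinearMap.congr_fun hφ x).symm
  have hs : algebraMap R p.asIdeal.ResidueField s ≠ 0 :=
    fun h ↦ s.2 (Ideal.algebraMap_residueField_eq_zero.mp h)
  rw [Submonoid.smul_def, Algebra.smul_def] at hsx
  exact (mul_ne_zero hs hx) hsx

lemma ExtPowVanishes.quotient_of_mem_support [IsNoetherianRing R] {L : Type u} [AddCommGroup L]
    [Module R L] [Module.Finite R L] {k : ℕ} (hL : ExtPowVanishes a k (.of R L))
    (hK : ∀ (K : Submodule R L), ExtPowVanishes a (k + 1) (.of R K)) (p : PrimeSpectrum R) :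
    p ∈ Module.support R L → ExtPowVanishes a k (.of R (R ⧸ p.asIdeal)) := by
  have : WellFoundedGT (PrimeSpectrum R) :=
    StrictMono.wellFoundedGT (f := PrimeSpectrum.asIdeal) fun _ _ h ↦ h
  induction p using WellFoundedGT.induction with
  | ind p ih =>
  intro hp
  obtain ⟨φ, hφ⟩ := exists_linearMap_quotient_ne_zero hp
  have hrange : ExtPowVanishes a k (.of R (LinearMap.range φ)) :=
    of_shortExact_right (kerComplex_shortExact φ.surjective_rangeRestrict) (hK _) hL
  refine of_exact (LinearMap.range φ).subtype_injective (LinearMap.range φ).mkQ_surjective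
    (LinearMap.exact_subtype_mkQ _) hrange (of_forall_mem_support _ fun q hq ↦ ?_)
  have hpq : p ≤ q := by
    have := Module.support_subset_of_surjective _ (LinearMap.range φ).mkQ_surjective hq
    rwa [support_quotient_ideal] at this
  refine ih q (lt_of_le_of_ne hpq ?_) (Module.mem_support_mono hpq hp)
  rintro rfl
  refine hφ (LinearMap.ext fun x ↦ ?_)
  obtain ⟨r, hr⟩ := Ideal.Quotient.mk_surjective (φ x)
  rw [← hr, LinearMap.zero_apply, Ideal.Quotient.eq_zero_iff_mem]
  refine Module.annihilator_le_of_mem_support hq (Module.mem_annihilator.mpr fun y ↦ ?_)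
  obtain ⟨y, rfl⟩ := Submodule.mkQ_surjective _ y
  obtain ⟨y, rfl⟩ := Ideal.Quotient.mk_surjective y
  rw [← map_smul, Submodule.mkQ_apply, Submodule.Quotient.mk_eq_zero]
  refine ⟨y • x, ?_⟩
  rw [map_smul, ← hr]
  change Ideal.Quotient.mk p.asIdeal (y * r) = Ideal.Quotient.mk p.asIdeal (r * y)
  rw [mul_comm]

/-- The vanishing of local cohomology in all degrees `≥ c` only depends on the support. -/
lemma ExtPowVanishes.of_support_subset [IsNoetherianRing R] {d : ℕ}
    (hd : ∀ q : PrimeSpectrum R, Order.coheight q < d) {L : Type u} [AddCommGroup L]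
    [Module R L] [Module.Finite R L] {c : ℕ} (hL : ∀ k, c ≤ k → ExtPowVanishes a k (.of R L))
    (m : ℕ) : ∀ (k : ℕ) (_ : c ≤ k) (_ : d ≤ k + m) (N : Type u) [AddCommGroup N] [Module R N]
      [Module.Finite R N], Module.support R N ⊆ Module.support R L →
        ExtPowVanishes a k (.of R N) := by
  induction m with
  | zero => exact fun k _ hk N _ _ _ _ ↦ extPowVanishes_of_coheight_lt d k hk N fun q _ ↦ hd q
  | succ m ih =>
    intro k hck hk N _ _ _ hN
    refine of_forall_mem_support N fun q hq ↦
      quotient_of_mem_support (hL k hck) (fun K ↦ ?_) q (hN hq)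
    exact ih (k + 1) (by lia) (by lia) K
      (Module.support_subset_of_injective _ K.subtype_injective)

lemma support_subset_support_tensorProduct [IsNoetherianRing R] {M N : Type u} [AddCommGroup M]
    [Module R M] [Module.Finite R M] [AddCommGroup N] [Module R N] [Module.Finite R N]
    (h : Module.support R N ⊆ Module.support R M) :
    Module.support R N ⊆ Module.support R (M ⊗[R] N) := by
  intro p hN
  have hM := h hN
  rw [Module.mem_support_iff_nontrivial_residueField_tensorProduct] at hM hN ⊢
  exact (AlgebraTensorModule.distribBaseChange R p.asIdeal.ResidueField M N).toEquiv.nontrivial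

section DualComplex

variable {ι : Type*} {c : ComplexShape ι} {K L : HomologicalComplex (ModuleCat.{u} R)ᵒᵖ c} {i : ι}

/-- For a complex `K` in the opposite category of modules, the cocycle `f` of the dual complex
represents the cohomology class `z`. -/
def Represents (f : (K.X i).unop) (z : (K.homology i).unop) : Prop :=
  ∃ w : (K.opcycles i).unop, (K.pOpcycles i).unop w = f ∧ (K.homologyι i).unop w = z

lemma exists_represents (z : (K.homology i).unop) :
    ∃ f, (K.d (c.prev i) i).unop f = 0 ∧ Represents f z := by
  obtain ⟨w, rfl⟩ := (ModuleCat.epi_iff_surjective (K.homologyι i).unop).mp inferInstance z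
  refine ⟨_, ?_, w, rfl, rfl⟩
  rw [← ConcreteCategory.comp_apply, ← unop_comp, K.d_pOpcycles]
  rfl

lemma exists_represented {f : (K.X i).unop} (hf : (K.d (c.prev i) i).unop f = 0) :
    ∃ z : (K.homology i).unop, Represents f z := by
  have := (ShortComplex.exact_of_g_is_cokernel (.mk (K.d (c.prev i) i) (K.pOpcycles i) (by simp))
    (K.opcyclesIsCokernel _ i rfl)).unop
  rw [ShortComplex.moduleCat_exact_iff] at this
  obtain ⟨w, hw⟩ := this f hf
  exact ⟨_, w, hw, rfl⟩

lemma Represents.eq_zero_iff {f : (K.X i).unop} {z : (K.homology i).unop} (h : Represents f z) :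
    z = 0 ↔ ∃ b, (K.d i (c.next i)).unop b = f := by
  obtain ⟨w, rfl, rfl⟩ := h
  have h := (ShortComplex.exact_of_f_is_kernel
    (.mk (K.homologyι i) (K.fromOpcycles i (c.next i)) (by simp)) (K.homologyIsKernel i _ rfl)).unop
  rw [ShortComplex.moduleCat_exact_iff] at h
  rw [← K.p_fromOpcycles]
  constructor
  · intro hw
    obtain ⟨b, hb⟩ := h w hw
    exact ⟨b, congr((K.pOpcycles i).unop $hb)⟩
  · rintro ⟨b, hb⟩
    have hw : (K.fromOpcycles i (c.next i)).unop b = w :=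
      (ModuleCat.mono_iff_injective (K.pOpcycles i).unop).mp inferInstance hb
    rw [← hw, ← ConcreteCategory.comp_apply, ← unop_comp, K.homologyι_comp_fromOpcycles]
    rfl

lemma Represents.map (φ : L ⟶ K) {f : (K.X i).unop} {z : (K.homology i).unop}
    (h : Represents f z) :
    Represents ((φ.f i).unop f) ((HomologicalComplex.homologyMap φ i).unop z) := by
  obtain ⟨w, rfl, rfl⟩ := h
  refine ⟨(HomologicalComplex.opcyclesMap φ i).unop w, ?_, ?_⟩
  · rw [← ConcreteCategory.comp_apply, ← unop_comp, HomologicalComplex.p_opcyclesMap]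
    rfl
  · rw [← ConcreteCategory.comp_apply, ← unop_comp, ← HomologicalComplex.homologyι_naturality]
    rfl

end DualComplex

section LeftDerived

variable {X : ModuleCat.{u} R} (F : ModuleCat.{u} R ⥤ (ModuleCat.{u} R)ᵒᵖ) [F.Additive] {i : ℕ}

/-- The cocycle `f` on a projective resolution of `X` represents the class `x` in the value at `X`
of the `i`-th derived functor. -/
def LeftDerivedRepresents (P : ProjectiveResolution X)
    (f : (((F.mapHomologicalComplex _).obj P.complex).X i).unop)
    (x : ((F.leftDerived i).obj X).unop) : Prop :=
  ∃ z : (((F.mapHomologicalComplex _).obj P.complex).homology i).unop,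
    Represents f z ∧ (P.isoLeftDerivedObj F i).hom.unop z = x

lemma exists_leftDerivedRepresents (P : ProjectiveResolution X)
    (x : ((F.leftDerived i).obj X).unop) :
    ∃ f, (((F.mapHomologicalComplex _).obj P.complex).d ((ComplexShape.down ℕ).prev i) i).unop f = 0
      ∧ LeftDerivedRepresents F P f x := by
  obtain ⟨f, hf, h⟩ := exists_represents ((P.isoLeftDerivedObj F i).inv.unop x)
  refine ⟨f, hf, _, h, ?_⟩
  have : (P.isoLeftDerivedObj F i).inv.unop ≫ (P.isoLeftDerivedObj F i).hom.unop = 𝟙 _ := by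
    rw [← unop_comp, Iso.hom_inv_id, unop_id]
  exact congr($this x)

lemma exists_leftDerivedRepresented (P : ProjectiveResolution X)
    {f : (((F.mapHomologicalComplex _).obj P.complex).X i).unop}
    (hf : (((F.mapHomologicalComplex _).obj P.complex).d
      ((ComplexShape.down ℕ).prev i) i).unop f = 0) :
    ∃ x : ((F.leftDerived i).obj X).unop, LeftDerivedRepresents F P f x := by
  obtain ⟨z, hz⟩ := exists_represented hf
  exact ⟨_, z, hz, rfl⟩

variable {F}

lemma LeftDerivedRepresents.eq_zero_iff {P : ProjectiveResolution X}
    {f : (((F.mapHomologicalComplex _).obj P.complex).X i).unop}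
    {x : ((F.leftDerived i).obj X).unop} (h : LeftDerivedRepresents F P f x) :
    x = 0 ↔ ∃ b, (((F.mapHomologicalComplex _).obj P.complex).d i
      ((ComplexShape.down ℕ).next i)).unop b = f := by
  obtain ⟨z, hz, rfl⟩ := h
  rw [← hz.eq_zero_iff]
  exact map_eq_zero_iff _ ((ModuleCat.mono_iff_injective (P.isoLeftDerivedObj F i).hom.unop).mp
    inferInstance)

lemma LeftDerivedRepresents.map {X' : ModuleCat.{u} R} {g : X' ⟶ X} {P : ProjectiveResolution X}
    {P' : ProjectiveResolution X'} (φ : P'.Hom P g)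
    {f : (((F.mapHomologicalComplex _).obj P.complex).X i).unop}
    {x : ((F.leftDerived i).obj X).unop} (h : LeftDerivedRepresents F P f x) :
    LeftDerivedRepresents F P' ((((F.mapHomologicalComplex _).map φ.hom).f i).unop f)
      (((F.leftDerived i).map g).unop x) := by
  obtain ⟨z, hz, rfl⟩ := h
  refine ⟨_, hz.map ((F.mapHomologicalComplex _).map φ.hom), ?_⟩
  have := ProjectiveResolution.isoLeftDerivedObj_hom_naturality g P' P φ.hom
    φ.hom_f_zero_comp_π_f_zero F i
  exact congr(Quiver.Hom.unop $this z).symm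

end LeftDerived

section ExtComparison

variable {X Y : ModuleCat.{u} R} {i : ℕ}

lemma extMk_eq_zero_iff_exists (P : ProjectiveResolution X) (f : P.complex.X i ⟶ Y)
    (hf : P.complex.d (i + 1) i ≫ f = 0) :
    P.extMk f (i + 1) rfl hf = 0 ↔
      ∃ b, P.complex.d i ((ComplexShape.down ℕ).next i) ≫ b = f := by
  cases i with
  | succ i =>
    rw [P.extMk_eq_zero_iff f _ rfl hf i rfl, ChainComplex.next_nat_succ]
  | zero =>
    have : P.complex.d 0 ((ComplexShape.down ℕ).next 0) = 0 := P.complex.shape _ _ (by simp)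
    simp only [this, Limits.zero_comp, exists_const, ← P.extEquivCohomologyClass.apply_eq_iff_eq,
      P.extEquivCohomologyClass_extMk, P.extEquivCohomologyClass_zero,
      CochainComplex.HomComplex.CohomologyClass.mk_eq_zero_iff]
    rw [CochainComplex.HomComplex.Cocycle.toSingleMk_mem_coboundaries_iff _ _ _ _ _ 1 (by lia),
      ← cancel_epi (P.cochainComplexXIso (-(0 : ℕ)) 0 rfl).hom]
    have h1 : Limits.IsZero (P.cochainComplex.X 1) :=
      CochainComplex.isZero_of_isStrictlyLE _ 0 _
    refine ⟨fun ⟨g, hg⟩ ↦ ?_, fun h ↦ ⟨0, ?_⟩⟩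
    · simpa [h1.eq_of_src g 0] using hg
    · simpa using h

/-- The derived functor model of `Ext` and the one defined through the derived category have the
same vanishing under restriction. -/
def SameKernel (x : ((_root_.Ext R (ModuleCat.{u} R) i).obj (.op X)).obj Y)
    (e : Abelian.Ext X Y i) : Prop :=
  ∀ ⦃X' : ModuleCat.{u} R⦄ (g : X' ⟶ X),
    (((_root_.Ext R (ModuleCat.{u} R) i).map g.op).app Y) x = 0 ↔
      (Ext.mk₀ g).comp e (zero_add i) = 0

lemma LeftDerivedRepresents.sameKernel {P : ProjectiveResolution X} {f : P.complex.X i ⟶ Y}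
    (hf : P.complex.d (i + 1) i ≫ f = 0)
    {x : ((_root_.Ext R (ModuleCat.{u} R) i).obj (.op X)).obj Y}
    (h : LeftDerivedRepresents (((linearYoneda R (ModuleCat.{u} R)).obj Y).rightOp) P f x) :
    SameKernel x (P.extMk f (i + 1) rfl hf) := by
  intro X' g
  let P' := projectiveResolution X'
  let φ : P'.Hom P g := ⟨ProjectiveResolution.lift g _ _,
    HomologicalComplex.congr_hom (ProjectiveResolution.lift_commutes g P' P) 0⟩
  rw [ProjectiveResolution.mk₀_comp_extMk f _ rfl hf φ, extMk_eq_zero_iff_exists]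
  exact (h.map φ).eq_zero_iff

lemma exists_sameKernel (x : ((_root_.Ext R (ModuleCat.{u} R) i).obj (.op X)).obj Y) :
    ∃ e : Abelian.Ext X Y i, SameKernel x e := by
  obtain ⟨f, hf, h⟩ := exists_leftDerivedRepresents
    (((linearYoneda R (ModuleCat.{u} R)).obj Y).rightOp) (projectiveResolution X) x
  rw [ChainComplex.prev] at hf
  exact ⟨_, h.sameKernel hf⟩

lemma exists_sameKernel' (e : Abelian.Ext X Y i) :
    ∃ x : ((_root_.Ext R (ModuleCat.{u} R) i).obj (.op X)).obj Y, SameKernel x e := by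
  obtain ⟨f, hf, rfl⟩ := (projectiveResolution X).extMk_surjective e _ rfl
  obtain ⟨x, hx⟩ := exists_leftDerivedRepresented
    (((linearYoneda R (ModuleCat.{u} R)).obj Y).rightOp) (projectiveResolution X) (i := i) (f := f)
    (by rw [ChainComplex.prev]; exact hf)
  exact ⟨x, LeftDerivedRepresents.sameKernel hf hx⟩

end ExtComparison

section Colimit

open Limits

lemma subsingleton_iff_of_isColimit {J : Type} [SmallCategory J] [IsFiltered J]
    {F : J ⥤ ModuleCat.{u} R} {c : Cocone F} (hc : IsColimit c) :
    Subsingleton c.pt ↔ ∀ (j : J) (x : F.obj j), ∃ (k : J) (f : j ⟶ k), F.map f x = 0 := by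
  have := preservesFilteredColimitsOfSize_shrink.{0, u, 0, u} (forget (ModuleCat.{u} R))
  constructor
  · intro _ j x
    obtain ⟨k, f, hf⟩ := (IsColimit.eq_iff' hc x (0 : F.obj j)).1
      (Subsingleton.elim (α := c.pt) _ _)
    exact ⟨k, f, hf.trans (map_zero _)⟩
  · refine fun h ↦ subsingleton_of_forall_eq 0 fun y ↦ ?_
    obtain ⟨j, x, rfl⟩ := Concrete.isColimit_exists_rep F hc y
    obtain ⟨k, f, hf⟩ := h j x
    rw [← c.w f, ModuleCat.comp_apply, hf, map_zero]

lemma subsingleton_localCohomology_iff_extPowVanishes (a : Ideal R) (i : ℕ)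
    (N : ModuleCat.{u} R) :
    Subsingleton ((localCohomology a i).obj N) ↔ ExtPowVanishes a i N := by
  have hc := isColimitOfPreserves ((evaluation _ _).obj N)
    (colimit.isColimit (localCohomology.diagram (localCohomology.idealPowersDiagram a) i))
  refine (subsingleton_iff_of_isColimit hc).trans ⟨fun h t e ↦ ?_, fun h j x ↦ ?_⟩
  · obtain ⟨x, hx⟩ := exists_sameKernel' e
    obtain ⟨k, f, hf⟩ := h (.op (.op t)) x
    exact ⟨k.unop.unop, leOfHom f.unop.unop, (hx _).1 hf⟩
  · obtain ⟨e, he⟩ := exists_sameKernel x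
    obtain ⟨s, h, hs⟩ := h j.unop.unop e
    exact ⟨.op (.op s), (homOfLE h).op.op, (he _).2 hs⟩

end Colimit

lemma cohDim_le_of_support_subset [IsNoetherianRing R] (hfin : ringKrullDim R ≠ ⊤) (a : Ideal R)
    (L N : ModuleCat.{u} R) [Module.Finite R L] [Module.Finite R N]
    (h : Module.support R N ⊆ Module.support R L) :
    cohDim R a N ≤ cohDim R a L := by
  obtain ⟨d, hd⟩ : ∃ d : ℕ, ringKrullDim R < d := by
    generalize ringKrullDim R = x at hfin
    match x, hfin with
    | ⊥, _ => exact ⟨0, WithBot.bot_lt_coe _⟩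
    | (n : ℕ), _ => exact ⟨n + 1, by exact_mod_cast n.lt_succ_self⟩
  have hd (q : PrimeSpectrum R) : Order.coheight q < d := by
    exact_mod_cast (Order.coheight_le_krullDim q).trans_lt hd
  refine iSup₂_le fun i hi ↦ ?_
  obtain ⟨k, hik, hk⟩ : ∃ k, i ≤ k ∧ ¬ ExtPowVanishes a k L := by
    by_contra! hL
    exact hi <| (subsingleton_localCohomology_iff_extPowVanishes a i N).2 <|
      ExtPowVanishes.of_support_subset hd hL d i le_rfl (Nat.le_add_left d i) N h
  calc (i : WithBot ℕ∞) ≤ k := by exact_mod_cast hik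
    _ ≤ cohDim R a L :=
      le_iSup₂_of_le k (mt (subsingleton_localCohomology_iff_extPowVanishes a k L).1 hk) le_rfl

lemma projDim_nonneg (M : ModuleCat.{u} R) : 0 ≤ projDim R M :=
  le_sInf <| by
    rintro _ ⟨n, rfl, -⟩
    exact_mod_cast n.zero_le

end LocalCohomologyVanishing

/-- Theorem 3.3(i), module case: over a commutative Noetherian ring `R` of finite
Krull dimension, if `M`, `N` are finitely generated, `M` has finite projective
dimension and `Supp_R N ⊆ Supp_R M`, then
`cd(a, N) ≤ cd(a, M ⊗_R N) + proj.dim_R M`. -/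
theorem cohDim_le_cohDim_tensor_add_projDim (R : Type u) [CommRing R] [IsNoetherianRing R]
    (hfin : ringKrullDim R ≠ ⊤) (a : Ideal R)
    (M N : ModuleCat.{u} R) [Module.Finite R M] [Module.Finite R N]
    (hpd : ∃ n : ℕ, projDimLE R M n)
    (hsupp : Module.support R N ⊆ Module.support R M) :
    cohDim R a N ≤ cohDim R a (ModuleCat.of R (M ⊗[R] N)) + projDim R M := by
  calc
    cohDim R a N ≤ cohDim R a (ModuleCat.of R (M ⊗[R] N)) :=
      cohDim_le_of_support_subset hfin a (.of R (M ⊗[R] N)) N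
        (support_subset_support_tensorProduct hsupp)
    _ ≤ cohDim R a (ModuleCat.of R (M ⊗[R] N)) + projDim R M :=
      le_add_of_nonneg_right (projDim_nonneg M)
end

section
/- Let R be a commutative Noetherian ring of finite Krull dimension, let a be an ideal of R, and let M and N be finitely generated R-modules with M of finite projective dimension and Supp_R N ⊆ Supp_R M. Then cd(a,N) ≤ sup over i ∈ ℕ of (cd(a, Ext^i_R(M,N)) + i); that is, whenever H^j_a(N) ≠ 0 there exist i, j' ≥ 0 with H^{j'}_a(Ext^i_R(M,N)) ≠ 0 and j ≤ j' + i. (Module case of Theorem 3.3(ii)/Corollary 3.4: -inf RΓ_a(Y) + inf X ≤ -inf RΓ_a(RHom_R(X,Y)) when Supp Y ⊆ Supp X.) -/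
/-!
Common definitions: Ext modules, dimension of a module (Krull dimension of its
support, in `WithBot ℕ∞`, with `⊥` for the zero module), projective/injective
dimension via the Ext-vanishing characterization, and cohomological dimension
with respect to an ideal via local cohomology.
-/

open CategoryTheory TensorProduct

universe u

open CategoryTheory.Limits Opposite

namespace CategoryTheory.ProjectiveResolution

/-- The map of `Hom` complexes. -/
noncomputable def linearYonedaMap {C : Type*} [Category* C] [Abelian C]
    {K L : ChainComplex C ℕ} (φ : K ⟶ L) (A : Type*) [Ring A] [Linear A C] (Y : C) :
    L.linearYonedaObj A Y ⟶ K.linearYonedaObj A Y :=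
  (HomologicalComplex.unopFunctor _ _).map
    ((((linearYoneda A C).obj Y).rightOp.mapHomologicalComplex _).map φ).op

lemma comp_comp_inv_eq {D : Type*} [Category* D] {A A' H H' U U' : D} {a : A ⟶ A'}
    {b : H ⟶ H'} {m : U ⟶ U'} {i : A ⟶ H} {i' : A' ⟶ H'} {u : U ≅ H} {u' : U' ≅ H'}
    (h₁ : a ≫ i' = i ≫ b) (h₂ : u.hom ≫ b = m ≫ u'.hom) :
    a ≫ i' ≫ u'.inv = (i ≫ u.inv) ≫ m := by
  rw [reassoc_of% h₁, Category.assoc, ← cancel_mono u'.hom]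
  simp [← h₂]

lemma isoExt_hom_naturality {R : Type*} [Ring R] {C : Type*} [Category* C] [Abelian C] [Linear R C]
    [EnoughProjectives C] {X X' : C} {P : ProjectiveResolution X} {P' : ProjectiveResolution X'}
    {g : X' ⟶ X} (φ : Hom P' P g) (n : ℕ) (Y : C) :
    ((Ext R C n).map g.op).app Y ≫ (P'.isoExt n Y).hom =
      (P.isoExt (R := R) n Y).hom ≫
        HomologicalComplex.homologyMap (linearYonedaMap φ.hom R Y) n :=
  comp_comp_inv_eq
    (congrArg Quiver.Hom.unop (isoLeftDerivedObj_inv_naturality g P' P φ.hom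
      (φ.hom_f_zero_comp_π_f_zero.trans (by rw [ChainComplex.single₀_map_f_zero]; rfl))
      ((linearYoneda R C).obj Y).rightOp n))
    (congrArg Quiver.Hom.unop
      (HomologicalComplex.homologyOp_hom_naturality (linearYonedaMap φ.hom R Y) n))

section

open CochainComplex.HomComplex

variable {C : Type*} [Category* C] [Abelian C] {X : C} (P : ProjectiveResolution X)
  {R : Type*} [CommRing R] [Linear R C] (Y : C) (n : ℕ)

variable (R) in
/-- A cocycle of the `Hom` complex of a projective resolution, as a morphism. -/
noncomputable def cyclesHom (z : (P.complex.linearYonedaObj R Y).cycles n) : P.complex.X n ⟶ Y :=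
  (P.complex.linearYonedaObj R Y).iCycles n z

variable (R) in
lemma d_comp_cyclesHom (z : (P.complex.linearYonedaObj R Y).cycles n) :
    P.complex.d (n + 1) n ≫ P.cyclesHom R Y n z = 0 :=
  congrArg (fun k => k.hom z) ((P.complex.linearYonedaObj R Y).iCycles_d n (n + 1))

lemma exists_cyclesHom_eq (f : P.complex.X n ⟶ Y) (hf : P.complex.d (n + 1) n ≫ f = 0) :
    ∃ z, P.cyclesHom R Y n z = f := by
  let K := P.complex.linearYonedaObj R Y
  have hex := ShortComplex.exact_of_f_is_kernel
    (.mk (K.iCycles n) (K.d n (n + 1)) (K.iCycles_d _ _)) (K.cyclesIsKernel n (n + 1) (by simp))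
  rw [ShortComplex.moduleCat_exact_iff] at hex
  exact hex f hf

lemma homologyπ_eq_zero_iff (z : (P.complex.linearYonedaObj R Y).cycles n) :
    (P.complex.linearYonedaObj R Y).homologyπ n z = 0 ↔
      ∃ g : (P.complex.linearYonedaObj R Y).X ((ComplexShape.up ℕ).prev n),
        (P.complex.linearYonedaObj R Y).d _ n g = (P.complex.linearYonedaObj R Y).iCycles n z := by
  let K := P.complex.linearYonedaObj R Y
  have hex := ShortComplex.exact_of_g_is_cokernel
    (.mk (K.toCycles _ n) (K.homologyπ n) (K.toCycles_comp_homologyπ _ n))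
    (K.homologyIsCokernel _ n rfl)
  rw [ShortComplex.moduleCat_exact_iff] at hex
  have hi : Function.Injective (K.iCycles n) := (ModuleCat.mono_iff_injective _).1 inferInstance
  have hK (g) : K.iCycles n (K.toCycles ((ComplexShape.up ℕ).prev n) n g) = K.d _ n g :=
    congrArg (fun k => k.hom g) (K.toCycles_i _ n)
  refine ⟨fun h ↦ ?_, fun ⟨g, hg⟩ ↦ ?_⟩
  · obtain ⟨g, rfl⟩ := hex z h
    exact ⟨g, (hK g).symm⟩
  · obtain rfl : K.toCycles _ n g = z := hi ((hK g).trans hg)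
    exact congrArg (fun k => k.hom g) (K.toCycles_comp_homologyπ _ n)

variable [HasExt C]

lemma extMk_zero_eq_zero_iff {Y : C} (f : P.complex.X 0 ⟶ Y) (m : ℕ) (hm : 0 + 1 = m)
    (hf : P.complex.d m 0 ≫ f = 0) :
    P.extMk f m hm hf = 0 ↔ f = 0 := by
  refine ⟨fun h ↦ ?_, fun h ↦ by subst h; simp⟩
  simp only [← P.extEquivCohomologyClass.apply_eq_iff_eq,
    extEquivCohomologyClass_extMk, extEquivCohomologyClass_zero,
    CohomologyClass.mk_eq_zero_iff] at h
  rw [Cocycle.toSingleMk_mem_coboundaries_iff _ _ _ _ _ 1 (by lia)] at h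
  obtain ⟨g, hg⟩ := h
  have h0 : IsZero (P.cochainComplex.X 1) := P.cochainComplex.isZero_of_isStrictlyLE 0 1
  rw [← cancel_epi (P.cochainComplexXIso (-(0 : ℕ)) 0 rfl).hom, comp_zero, ← hg,
    h0.eq_of_src g 0, comp_zero]

variable (R) in
/-- The class in `Ext` of a cocycle of the `Hom` complex of a projective resolution. -/
noncomputable def cyclesToExt :
    (P.complex.linearYonedaObj R Y).cycles n →ₗ[R] Abelian.Ext X Y n where
  toFun z := P.extMk (P.cyclesHom R Y n z) (n + 1) rfl (P.d_comp_cyclesHom R Y n z)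
  map_add' z w := by
    rw [add_extMk]
    congr 1
    exact map_add ((P.complex.linearYonedaObj R Y).iCycles n).hom z w
  map_smul' r z := by
    rw [RingHom.id_apply, Abelian.Ext.smul_eq_comp_mk₀, extMk_comp_mk₀]
    congr 1
    rw [Linear.comp_smul, Category.comp_id]
    exact map_smul ((P.complex.linearYonedaObj R Y).iCycles n).hom r z

lemma cyclesToExt_surjective : Function.Surjective (P.cyclesToExt R Y n) := by
  intro x
  obtain ⟨f, hf, rfl⟩ := P.extMk_surjective x (n + 1) rfl
  obtain ⟨z, rfl⟩ := P.exists_cyclesHom_eq (R := R) Y n f hf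
  exact ⟨z, rfl⟩

lemma ker_homologyπ : LinearMap.ker ((P.complex.linearYonedaObj R Y).homologyπ n).hom =
    LinearMap.ker (P.cyclesToExt R Y n) := by
  ext z
  simp only [LinearMap.mem_ker]
  refine (P.homologyπ_eq_zero_iff Y n z).trans (Iff.trans ?_ (show
    P.extMk (P.cyclesHom R Y n z) (n + 1) rfl (P.d_comp_cyclesHom R Y n z) = 0 ↔ _ from Iff.rfl))
  cases n with
  | zero =>
    rw [extMk_zero_eq_zero_iff, HomologicalComplex.shape _ _ _ (by simp)]
    exact ⟨fun ⟨_, hg⟩ ↦ hg.symm, fun h ↦ ⟨0, h.symm⟩⟩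
  | succ p =>
    rw [P.extMk_eq_zero_iff _ _ _ _ p rfl, CochainComplex.prev_nat_succ]
    rfl

variable (R) in
/-- The derived functor definition of `Ext` agrees with the derived category one. -/
noncomputable def extEquiv [EnoughProjectives C] :
    ((Ext R C n).obj (Opposite.op X)).obj Y ≃ₗ[R] Abelian.Ext X Y n :=
  (P.isoExt n Y).toLinearEquiv ≪≫ₗ
    (LinearMap.quotKerEquivOfSurjective _ ((ModuleCat.epi_iff_surjective
      ((P.complex.linearYonedaObj R Y).homologyπ n)).1 inferInstance)).symm ≪≫ₗ
    Submodule.quotEquivOfEq _ _ (P.ker_homologyπ Y n) ≪≫ₗ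
    LinearMap.quotKerEquivOfSurjective _ (P.cyclesToExt_surjective Y n)

lemma extEquiv_apply [EnoughProjectives C] (x : ((Ext R C n).obj (Opposite.op X)).obj Y)
    (z : (P.complex.linearYonedaObj R Y).cycles n)
    (h : (P.isoExt n Y).hom x = (P.complex.linearYonedaObj R Y).homologyπ n z) :
    P.extEquiv R Y n x = P.cyclesToExt R Y n z := by
  have h₁ := LinearMap.quotKerEquivOfSurjective_symm_apply _ ((ModuleCat.epi_iff_surjective
      ((P.complex.linearYonedaObj R Y).homologyπ n)).1 inferInstance) z
  have h₂ : P.extEquiv R Y n x = LinearMap.quotKerEquivOfSurjective _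
      (P.cyclesToExt_surjective Y n) (Submodule.quotEquivOfEq _ _ (P.ker_homologyπ Y n)
        ((LinearMap.quotKerEquivOfSurjective _ ((ModuleCat.epi_iff_surjective
      ((P.complex.linearYonedaObj R Y).homologyπ n)).1 inferInstance)).symm
        ((P.isoExt n Y).hom x))) := rfl
  rw [h₂, h]
  erw [h₁]
  rfl

lemma extEquiv_naturality [EnoughProjectives C] {X' : C} (P' : ProjectiveResolution X')
    (g : X' ⟶ X) (x : ((Ext R C n).obj (Opposite.op X)).obj Y) :
    P'.extEquiv R Y n (((Ext R C n).map g.op).app Y x) =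
      (Abelian.Ext.mk₀ g).comp (P.extEquiv R Y n x) (zero_add n) := by
  let φ : Hom P' P g :=
    { hom := lift g P' P
      hom_f_zero_comp_π_f_zero := HomologicalComplex.congr_hom (lift_commutes g P' P) 0 }
  obtain ⟨z, hz⟩ := (ModuleCat.epi_iff_surjective
    ((P.complex.linearYonedaObj R Y).homologyπ n)).1 inferInstance ((P.isoExt n Y).hom x)
  let w := HomologicalComplex.cyclesMap (linearYonedaMap φ.hom R Y) n z
  have h₁ : (P'.isoExt n Y).hom (((Ext R C n).map g.op).app Y x) =
      (P'.complex.linearYonedaObj R Y).homologyπ n w := by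
    have e₁ := congrArg (fun k => k.hom x) (isoExt_hom_naturality φ n Y (R := R))
    have e₂ := congrArg (fun k => k.hom z)
      (HomologicalComplex.homologyπ_naturality (linearYonedaMap φ.hom R Y) n)
    refine e₁.trans (Eq.trans ?_ e₂)
    exact congrArg (HomologicalComplex.homologyMap (linearYonedaMap φ.hom R Y) n).hom hz.symm
  have h₂ : P'.cyclesHom R Y n w = φ.hom.f n ≫ P.cyclesHom R Y n z :=
    congrArg (fun k => k.hom z) (HomologicalComplex.cyclesMap_i (linearYonedaMap φ.hom R Y) n)
  rw [extEquiv_apply P' Y n _ w h₁, extEquiv_apply P Y n x z hz.symm]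
  have h₃ := mk₀_comp_extMk (P.cyclesHom R Y n z) (n + 1) rfl (P.d_comp_cyclesHom R Y n z) φ
  refine Eq.trans ?_ h₃.symm
  change P'.extMk (P'.cyclesHom R Y n w) (n + 1) rfl (P'.d_comp_cyclesHom R Y n w) = _
  simp only [h₂]

end

end CategoryTheory.ProjectiveResolution

namespace localCohomology

variable {R : Type u} [CommRing R] (a : Ideal R)

/-- The quotient `R ⧸ a ^ t`. -/
noncomputable abbrev powQuot (t : ℕ) : ModuleCat.{u} R :=
  (ringModIdeals (idealPowersDiagram a)).obj (op t)

variable {a} in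
/-- The projection `R ⧸ a ^ s ⟶ R ⧸ a ^ t` for `t ≤ s`. -/
noncomputable abbrev powQuotMap {t s : ℕ} (h : t ≤ s) : powQuot a s ⟶ powQuot a t :=
  (ringModIdeals (idealPowersDiagram a)).map (homOfLE h).op

variable {a} in
lemma powQuotMap_comp {t s r : ℕ} (h : t ≤ s) (h' : s ≤ r) :
    powQuotMap (a := a) h' ≫ powQuotMap h = powQuotMap (h.trans h') := by
  rw [← Functor.map_comp]
  rfl

variable {a} in
/-- The class `ξ` dies in the local cohomology module. -/
def Dies {t j : ℕ} {M : ModuleCat.{u} R} (ξ : Abelian.Ext (powQuot a t) M j) : Prop :=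
  ∃ (s : ℕ) (h : t ≤ s), (Abelian.Ext.mk₀ (powQuotMap h)).comp ξ (zero_add j) = 0

/-- The vanishing of the local cohomology module of `M` in degree `j`, expressed through the
classes in `Ext^j(R ⧸ a ^ t, M)`. -/
def Vanishes (j : ℕ) (M : ModuleCat.{u} R) : Prop :=
  ∀ (t : ℕ) (ξ : Abelian.Ext (powQuot a t) M j), Dies ξ

lemma subsingleton_iff_vanishes (j : ℕ) (M : ModuleCat.{u} R) :
    Subsingleton ((localCohomology a j).obj M) ↔ Vanishes a j M := by
  let D := diagram (idealPowersDiagram a) j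
  have : HasColimit D := hasColimitDiagram.{u, 0} _ _
  have hc : IsColimit (((evaluation _ _).obj M).mapCocone (colimit.cocone D)) :=
    isColimitOfPreserves ((evaluation _ _).obj M) (colimit.isColimit D)
  have : PreservesColimit (D ⋙ (evaluation _ _).obj M) (forget (ModuleCat.{u} R)) :=
    have : PreservesFilteredColimitsOfSize.{0, 0} (forget (ModuleCat.{u} R)) :=
      preservesFilteredColimitsOfSize_shrink.{0, u, 0, u} _
    inferInstance
  have hzero (t : ℕ) (x : (D ⋙ (evaluation _ _).obj M).obj (op (op t))) :
      (((evaluation _ _).obj M).mapCocone (colimit.cocone D)).ι.app (op (op t)) x = 0 ↔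
        Dies ((projectiveResolution (powQuot a t)).extEquiv R M j x) := by
    rw [← map_zero ((((evaluation _ _).obj M).mapCocone (colimit.cocone D)).ι.app
      (op (op t))).hom]
    refine (Concrete.isColimit_rep_eq_iff_exists _ hc x 0).trans ⟨?_, ?_⟩
    · rintro ⟨⟨⟨s⟩⟩, f, g, h⟩
      refine ⟨s, leOfHom f.unop.unop, ?_⟩
      refine ((projectiveResolution (powQuot a t)).extEquiv_naturality M j
        (projectiveResolution (powQuot a s)) (powQuotMap (leOfHom f.unop.unop)) x).symm.trans ?_
      rw [map_zero] at h
      rw [LinearEquiv.map_eq_zero_iff]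
      exact h
    · rintro ⟨s, h, hs⟩
      refine ⟨op (op s), (homOfLE h).op.op, (homOfLE h).op.op, ?_⟩
      rw [map_zero]
      rw [← (projectiveResolution (powQuot a t)).extEquiv_naturality M j
        (projectiveResolution (powQuot a s)) (powQuotMap h) x, LinearEquiv.map_eq_zero_iff] at hs
      exact hs
  change Subsingleton (((evaluation _ _).obj M).mapCocone (colimit.cocone D)).pt ↔ _
  refine ⟨fun hs t ξ ↦ ?_, fun h ↦ subsingleton_of_forall_eq 0 fun y ↦ ?_⟩
  · obtain ⟨x, rfl⟩ := ((projectiveResolution (powQuot a t)).extEquiv R M j).surjective ξ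
    exact (hzero t x).1 (hs.elim _ _)
  · obtain ⟨⟨⟨t⟩⟩, x, rfl⟩ := Concrete.isColimit_exists_rep _ hc y
    exact (hzero t x).2 (h t _)

end localCohomology

namespace localCohomology

variable {R : Type u} [CommRing R] {a : Ideal R}

section
variable {t j : ℕ} {M N : ModuleCat.{u} R}

lemma Dies.of_comp {s : ℕ} {h : t ≤ s} {ξ : Abelian.Ext (powQuot a t) M j}
    (hξ : Dies ((Abelian.Ext.mk₀ (powQuotMap h)).comp ξ (zero_add j))) : Dies ξ := by
  obtain ⟨r, h', e⟩ := hξ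
  refine ⟨r, h.trans h', ?_⟩
  rwa [Abelian.Ext.mk₀_comp_mk₀_assoc, powQuotMap_comp] at e

lemma Dies.comp {ξ : Abelian.Ext (powQuot a t) M j} (hξ : Dies ξ) {k l : ℕ}
    (β : Abelian.Ext M N k) (h : j + k = l) : Dies (ξ.comp β h) := by
  obtain ⟨s, h', e⟩ := hξ
  refine ⟨s, h', ?_⟩
  rw [← Abelian.Ext.comp_assoc _ _ _ (zero_add j) h (by lia), e, Abelian.Ext.zero_comp]

lemma vanishes_of_isZero (h : IsZero M) : Vanishes a j M := by
  intro t ξ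
  refine ⟨t, le_rfl, ?_⟩
  have : ξ = 0 := by
    rw [← ξ.comp_mk₀_id, h.eq_of_src (𝟙 M) 0, Abelian.Ext.mk₀_zero, Abelian.Ext.comp_zero]
  rw [this, Abelian.Ext.comp_zero]

end

variable {S : ShortComplex (ModuleCat.{u} R)}

lemma Vanishes.of_shortExact_X₂ (hS : S.ShortExact) {j : ℕ} (h₁ : Vanishes a j S.X₁)
    (h₃ : Vanishes a j S.X₃) : Vanishes a j S.X₂ := by
  intro t ξ
  obtain ⟨s, hs, e⟩ := h₃ t (ξ.comp (Abelian.Ext.mk₀ S.g) (add_zero j))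
  rw [← Abelian.Ext.comp_assoc_of_third_deg_zero] at e
  obtain ⟨η, hη⟩ := Abelian.Ext.covariant_sequence_exact₂ _ hS _ e
  refine Dies.of_comp (h := hs) ?_
  rw [← hη]
  exact (h₁ s η).comp _ _

lemma Vanishes.of_shortExact_X₃ (hS : S.ShortExact) {j : ℕ} (h₂ : Vanishes a j S.X₂)
    (h₁ : Vanishes a (j + 1) S.X₁) : Vanishes a j S.X₃ := by
  intro t ξ
  obtain ⟨s, hs, e⟩ := h₁ t (ξ.comp hS.extClass rfl)
  rw [← Abelian.Ext.comp_assoc _ _ _ (zero_add j) rfl (by lia)] at e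
  obtain ⟨η, hη⟩ := Abelian.Ext.covariant_sequence_exact₃ _ hS _ rfl e
  refine Dies.of_comp (h := hs) ?_
  rw [← hη]
  exact (h₂ s η).comp _ _

end localCohomology

lemma ModuleCat.shortExact_of_function_exact {R : Type u} [Ring R] {L M N : Type u}
    [AddCommGroup L] [AddCommGroup M] [AddCommGroup N] [Module R L] [Module R M] [Module R N]
    {f : L →ₗ[R] M} {g : M →ₗ[R] N} (hf : Function.Injective f) (hg : Function.Surjective g)
    (h : Function.Exact f g) :
    (ModuleCat.shortComplexOfCompEqZero f g h.linearMap_comp_eq_zero).ShortExact :=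
  ModuleCat.shortComplex_shortExact _ h hf hg

section PowTorsion

variable {R : Type u} [CommRing R] (a : Ideal R) (M : Type*) [AddCommGroup M] [Module R M]

/-- The submodule of the elements killed by some power of `a`. -/
def Submodule.powTorsion : Submodule R M where
  carrier := {x | ∃ k, ∀ r ∈ a ^ k, r • x = 0}
  zero_mem' := ⟨0, by simp⟩
  add_mem' := by
    rintro x y ⟨k, hk⟩ ⟨l, hl⟩
    refine ⟨k + l, fun r hr ↦ ?_⟩
    rw [smul_add, hk r (Ideal.pow_le_pow_right (by lia) hr),
      hl r (Ideal.pow_le_pow_right (by lia) hr), add_zero]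
  smul_mem' := by
    rintro c x ⟨k, hk⟩
    exact ⟨k, fun r hr ↦ by rw [smul_comm, hk r hr, smul_zero]⟩

variable {M} in
lemma Submodule.mem_powTorsion {x : M} :
    x ∈ Submodule.powTorsion a M ↔ ∃ k, ∀ r ∈ a ^ k, r • x = 0 := Iff.rfl

lemma Submodule.powTorsion_powTorsion : powTorsion a (powTorsion a M) = ⊤ := by
  rw [eq_top_iff]
  rintro ⟨x, k, hk⟩ -
  exact ⟨k, fun r hr ↦ Subtype.ext (hk r hr)⟩

variable {a M} in
lemma LinearMap.map_mem_powTorsion {N : Type*} [AddCommGroup N] [Module R N] (f : M →ₗ[R] N)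
    {x : M} (hx : x ∈ Submodule.powTorsion a M) : f x ∈ Submodule.powTorsion a N := by
  obtain ⟨k, hk⟩ := hx
  exact ⟨k, fun r hr ↦ by rw [← map_smul, hk r hr, map_zero]⟩

lemma Submodule.exists_pow_smul_eq_zero_of_fg {N : Submodule R M} (hN : N.FG)
    (h : N ≤ powTorsion a M) : ∃ k, a ^ k • N = ⊥ := by
  obtain ⟨s, rfl⟩ := hN
  choose k hk using fun x : s ↦ h (subset_span x.2)
  refine ⟨s.attach.sup k, ?_⟩
  rw [eq_bot_iff, smul_le]
  intro r hr n hn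
  rw [mem_bot]
  induction hn using span_induction with
  | mem x hx => exact hk ⟨x, hx⟩ r (Ideal.pow_le_pow_right (Finset.le_sup (s.mem_attach _)) hr)
  | zero => simp
  | add x y _ _ hx hy => rw [smul_add, hx, hy, add_zero]
  | smul c x _ hx => rw [smul_comm, hx, smul_zero]

/-- The torsion submodule of an injective module is injective. -/
lemma Module.Injective.powTorsion [IsNoetherianRing R] (E : Type u) [AddCommGroup E] [Module R E]
    [Module.Injective R E] : Module.Injective R (Submodule.powTorsion a E) := by
  refine Module.Baer.injective fun I g ↦ ?_
  let g' : I →ₗ[R] E := (Submodule.powTorsion a E).subtype ∘ₗ g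
  obtain ⟨k, hk⟩ := Submodule.exists_pow_smul_eq_zero_of_fg a E (N := LinearMap.range g')
    (LinearMap.range_eq_map g' ▸ (Module.Finite.fg_top.map g'))
    (by rintro _ ⟨x, rfl⟩; exact (g x).2)
  obtain ⟨l, hl⟩ := Ideal.exists_pow_inf_eq_pow_smul a (M := R) I
  have hker : Submodule.comap I.subtype (a ^ (k + l)) ≤ LinearMap.ker g' := by
    intro x hx
    have h₁ : (x : R) ∈ a ^ k • I := by
      have : (x : R) ∈ a ^ (k + l) • ⊤ ⊓ I := ⟨by simpa using hx, x.2⟩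
      rw [hl (k + l) (by lia), Nat.add_sub_cancel] at this
      exact Submodule.smul_mono le_rfl inf_le_right this
    have h₂ : x ∈ a ^ k • (⊤ : Submodule R I) := by
      have : (a ^ k • (⊤ : Submodule R I)).map I.subtype = a ^ k • I := by
        rw [Submodule.map_smul'', Submodule.map_top, Submodule.range_subtype]
      rw [← this] at h₁
      obtain ⟨y, hy, e⟩ := h₁
      rwa [← Subtype.ext e]
    have h₃ := Submodule.mem_map_of_mem (f := g') h₂
    rwa [Submodule.map_smul'', Submodule.map_top, hk] at h₃
  obtain ⟨h, hh⟩ := Module.Injective.out (Q := E)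
    (Submodule.mapQ (Submodule.comap I.subtype (a ^ (k + l))) (a ^ (k + l)) I.subtype le_rfl)
    (by
      rw [← LinearMap.ker_eq_bot, Submodule.ker_mapQ]
      exact Submodule.mkQ_map_self _) (Submodule.liftQ _ g' hker)
  refine ⟨LinearMap.codRestrict _ (h ∘ₗ Submodule.mkQ _) fun x ↦ ⟨k + l, fun r hr ↦ ?_⟩,
    fun x hx ↦ Subtype.ext (hh (Submodule.Quotient.mk ⟨x, hx⟩))⟩
  rw [← map_smul]
  refine (congrArg h ((Submodule.Quotient.mk_eq_zero _).2 ?_)).trans (map_zero h)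
  exact Ideal.mul_mem_right _ _ hr

end PowTorsion

namespace localCohomology

variable {R : Type u} [CommRing R] {a : Ideal R}

lemma exists_shortExact_powTorsion [IsNoetherianRing R] (M : ModuleCat.{u} R)
    (hM : Submodule.powTorsion a M = ⊤) :
    ∃ (E Q : ModuleCat.{u} R) (f : M ⟶ E) (g : E ⟶ Q) (w : f ≫ g = 0),
      (ShortComplex.mk f g w).ShortExact ∧ Injective E ∧ Submodule.powTorsion a E = ⊤ := by
  obtain ⟨I, ι, hI, hι⟩ : ∃ (I : ModuleCat.{u} R) (ι : M ⟶ I), Injective I ∧ Mono ι :=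
    ⟨_, Injective.ι M, inferInstance, inferInstance⟩
  have : Module.Injective R I := Module.injective_module_of_injective_object (inj := hI) _ _
  have := Module.Injective.powTorsion a I
  let f : M →ₗ[R] Submodule.powTorsion a I :=
    LinearMap.codRestrict _ ι.hom
      fun x ↦ LinearMap.map_mem_powTorsion _ (hM ▸ Submodule.mem_top)
  have hf : Function.Injective f := by
    rw [LinearMap.injective_codRestrict_iff]
    exact (ModuleCat.mono_iff_injective _).1 hι
  exact ⟨.of R (Submodule.powTorsion a I), .of R (_ ⧸ LinearMap.range f),
    ModuleCat.ofHom f, ModuleCat.ofHom (LinearMap.range f).mkQ, _,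
    ModuleCat.shortExact_of_function_exact hf (Submodule.mkQ_surjective _)
      (LinearMap.exact_map_mkQ_range f),
    Module.injective_object_of_injective_module _ _, Submodule.powTorsion_powTorsion a _⟩

lemma exists_powQuotMap_comp_eq {t : ℕ} {M N : ModuleCat.{u} R}
    (hM : Submodule.powTorsion a M = ⊤) (g : M ⟶ N) [Epi g] (f : powQuot a t ⟶ N) :
    ∃ (s : ℕ) (h : t ≤ s) (f' : powQuot a s ⟶ M), powQuotMap h ≫ f = f' ≫ g := by
  obtain ⟨x, hx⟩ := (ModuleCat.epi_iff_surjective g).1 inferInstance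
    (f.hom (Submodule.Quotient.mk (1 : R)))
  obtain ⟨k, hk⟩ := (Submodule.mem_powTorsion a).1 (hM ▸ Submodule.mem_top (x := x))
  let f' : (R ⧸ a ^ (t + k)) →ₗ[R] M := Submodule.liftQ _ (LinearMap.toSpanSingleton R M x)
    fun r hr ↦ hk r (Ideal.pow_le_pow_right (by lia) hr)
  refine ⟨t + k, by lia, ModuleCat.ofHom f', ?_⟩
  ext : 1
  refine Submodule.linearMap_qext _ (LinearMap.ext_ring ?_)
  have e₁ : f' (Submodule.Quotient.mk (1 : R)) = x := one_smul R x
  change f.hom (Submodule.Quotient.mk (1 : R)) = g.hom (f' (Submodule.Quotient.mk (1 : R)))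
  rw [e₁]
  exact hx.symm

lemma vanishes_succ_of_powTorsion_eq_top [IsNoetherianRing R] (j : ℕ) (M : ModuleCat.{u} R)
    (hM : Submodule.powTorsion a M = ⊤) : Vanishes a (j + 1) M := by
  induction j generalizing M with
  | zero =>
    obtain ⟨E, Q, f, g, w, hS, hE, hE'⟩ := exists_shortExact_powTorsion M hM
    intro t ξ
    obtain ⟨η, rfl⟩ := Abelian.Ext.covariant_sequence_exact₁ _ hS ξ
      (Abelian.Ext.eq_zero_of_injective _) rfl
    obtain ⟨φ, rfl⟩ := (Abelian.Ext.mk₀_bijective _ _).2 η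
    have := hS.epi_g
    obtain ⟨s, h, φ', e⟩ := exists_powQuotMap_comp_eq hE' g φ
    refine ⟨s, h, ?_⟩
    rw [Abelian.Ext.mk₀_comp_mk₀_assoc, e, ← Abelian.Ext.mk₀_comp_mk₀_assoc, hS.comp_extClass,
      Abelian.Ext.comp_zero]
  | succ j ih =>
    obtain ⟨E, Q, f, g, w, hS, hE, hE'⟩ := exists_shortExact_powTorsion M hM
    intro t ξ
    obtain ⟨η, rfl⟩ := Abelian.Ext.covariant_sequence_exact₁ _ hS ξ
      (Abelian.Ext.eq_zero_of_injective _) rfl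
    refine (ih Q ?_ t η).comp _ _
    rw [eq_top_iff]
    rintro y -
    have := hS.epi_g
    obtain ⟨x, rfl⟩ := (ModuleCat.epi_iff_surjective g).1 inferInstance y
    exact LinearMap.map_mem_powTorsion g.hom (hE' ▸ Submodule.mem_top)

end localCohomology

section

variable {R : Type u} [CommRing R]

lemma PrimeSpectrum.lt_of_mem_support_of_surjective {p q : PrimeSpectrum R} {Q : Type*}
    [AddCommGroup Q] [Module R Q] {g : (R ⧸ p.asIdeal) →ₗ[R] Q} (hg : Function.Surjective g)
    {c : R} (hcp : c ∉ p.asIdeal) (hc : g (Ideal.Quotient.mk _ c) = 0)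
    (hq : q ∈ Module.support R Q) : p < q := by
  have hann := Module.annihilator_le_of_mem_support hq
  have key (r : R) (hr : g (Ideal.Quotient.mk _ r) = 0) : r ∈ q.asIdeal := by
    refine hann (Module.mem_annihilator.2 fun y ↦ ?_)
    obtain ⟨y, rfl⟩ := hg y
    obtain ⟨y, rfl⟩ := Ideal.Quotient.mk_surjective y
    have : r • Ideal.Quotient.mk p.asIdeal y = y • Ideal.Quotient.mk p.asIdeal r :=
      (map_mul (Ideal.Quotient.mk p.asIdeal) r y).symm.trans
        ((congrArg _ (mul_comm r y)).trans (map_mul _ y r))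
    rw [← map_smul, this, map_smul, hr, smul_zero]
  have hle : p ≤ q := fun r hr ↦ key r (by rw [Ideal.Quotient.eq_zero_iff_mem.2 hr, map_zero])
  exact lt_of_le_of_ne hle fun h ↦ hcp (h ▸ key c hc)

lemma PrimeSpectrum.mem_support_quotient_iff {p q : PrimeSpectrum R} :
    q ∈ Module.support R (R ⧸ p.asIdeal) ↔ p ≤ q := by
  have : RingHom.ker (algebraMap R (R ⧸ p.asIdeal)) = p.asIdeal := Ideal.mk_ker
  rw [Module.support_of_algebra, this]
  rfl

variable [IsNoetherianRing R] {P : ModuleCat.{u} R → Prop}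

/-- A property of modules which is stable under extensions holds for a finitely generated module
as soon as it holds for the quotients of `R` by the primes in the support. -/
lemma ModuleCat.prop_of_forall_quotient_prime (h0 : ∀ M, IsZero M → P M)
    (hext : ∀ S : ShortComplex (ModuleCat.{u} R), S.ShortExact → P S.X₁ → P S.X₃ → P S.X₂)
    (M : ModuleCat.{u} R) [Module.Finite R M]
    (h : ∀ q ∈ Module.support R M, P (.of R (R ⧸ q.asIdeal))) : P M := by
  suffices H : ∀ (N : Type u) [AddCommGroup N] [Module R N] [Module.Finite R N],
    (∀ q ∈ Module.support R N, P (.of R (R ⧸ q.asIdeal))) → P (.of R N) from H M h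
  intro N _ _ hN
  induction hN using IsNoetherianRing.induction_on_isQuotientEquivQuotientPrime R with
  | subsingleton N => exact fun _ ↦ h0 _ (ModuleCat.isZero_of_subsingleton _)
  | quotient N p e =>
    intro h
    refine hext _ (ModuleCat.shortExact_of_function_exact (f := e.symm.toLinearMap)
      (g := (0 : N →ₗ[R] PUnit.{u + 1})) e.symm.injective (Function.surjective_to_subsingleton _)
      ((LinearMap.exact_zero_iff_surjective _ _).2 e.symm.surjective)) (h p ?_)
      (h0 _ (ModuleCat.isZero_of_subsingleton _))
    rw [e.support_eq]
    exact PrimeSpectrum.mem_support_quotient_iff.2 le_rfl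
  | exact N₁ N₂ N₃ f g hf hg hfg h₁ h₃ =>
    intro h
    exact hext _ (ModuleCat.shortExact_of_function_exact hf hg hfg)
      (h₁ fun q hq ↦ h q (Module.support_subset_of_injective f hf hq))
      (h₃ fun q hq ↦ h q (Module.support_subset_of_surjective g hg hq))

end

namespace localCohomology

variable {R : Type u} [CommRing R] {a : Ideal R}

lemma smul_ext_powQuot_eq_zero {t j : ℕ} {M : ModuleCat.{u} R} {r : R} (hr : r ∈ a ^ t)
    (ξ : Abelian.Ext (powQuot a t) M j) : r • ξ = 0 := by
  have h : r • 𝟙 (powQuot a t) = 0 := by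
    ext : 1
    refine Submodule.linearMap_qext _ (LinearMap.ext_ring ?_)
    refine (Submodule.Quotient.mk_eq_zero _).2 ?_
    exact Ideal.mul_mem_right _ _ hr
  rw [← ξ.mk₀_id_comp, ← Abelian.Ext.smul_comp, ← Abelian.Ext.mk₀_smul, h, Abelian.Ext.mk₀_zero,
    Abelian.Ext.zero_comp]

variable [IsNoetherianRing R]

lemma Vanishes.of_forall_quotient_prime {j : ℕ} (M : ModuleCat.{u} R) [Module.Finite R M]
    (h : ∀ q ∈ Module.support R M, Vanishes a j (.of R (R ⧸ q.asIdeal))) : Vanishes a j M :=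
  ModuleCat.prop_of_forall_quotient_prime (fun _ hM ↦ vanishes_of_isZero hM)
    (fun _ hS h₁ h₃ ↦ h₁.of_shortExact_X₂ hS h₃) M h

lemma vanishes_quotient_of_coheight_lt (n : ℕ) (p : PrimeSpectrum R) (hp : Order.coheight p < n)
    (j : ℕ) (hj : n ≤ j) : Vanishes a j (.of R (R ⧸ p.asIdeal)) := by
  induction n generalizing p j with
  | zero => simp at hp
  | succ n ih =>
    obtain ⟨j, rfl⟩ : ∃ i, j = i + 1 := ⟨j - 1, by lia⟩
    by_cases hap : a ≤ p.asIdeal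
    · refine vanishes_succ_of_powTorsion_eq_top _ _ (eq_top_iff.2 fun x _ ↦ ⟨1, fun r hr ↦ ?_⟩)
      obtain ⟨x, rfl⟩ := Ideal.Quotient.mk_surjective x
      exact (map_mul (Ideal.Quotient.mk p.asIdeal) r x).symm.trans (Ideal.Quotient.eq_zero_iff_mem.2
        (Ideal.mul_mem_right _ _ (hap (by simpa using hr))))
    · obtain ⟨x, hxa, hxp⟩ := Set.not_subset.1 hap
      intro t ξ
      have hxt : x ^ t ∉ p.asIdeal := fun h ↦ hxp (p.2.mem_of_pow_mem _ h)
      let f : (R ⧸ p.asIdeal) →ₗ[R] (R ⧸ p.asIdeal) := x ^ t • LinearMap.id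
      have hf : Function.Injective f := by
        rw [← LinearMap.ker_eq_bot, LinearMap.ker_eq_bot']
        intro y hy
        obtain ⟨y, rfl⟩ := Ideal.Quotient.mk_surjective y
        have : Ideal.Quotient.mk p.asIdeal (x ^ t * y) = 0 := (map_mul _ _ _).trans hy
        rw [Ideal.Quotient.eq_zero_iff_mem] at this ⊢
        exact (p.2.mem_or_mem this).resolve_left hxt
      have hS := ModuleCat.shortExact_of_function_exact hf (Submodule.mkQ_surjective _)
        (LinearMap.exact_map_mkQ_range f)
      obtain ⟨η, rfl⟩ := Abelian.Ext.covariant_sequence_exact₁ _ hS ξ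
        ((ξ.smul_eq_comp_mk₀ (x ^ t)).symm.trans
          (smul_ext_powQuot_eq_zero (Ideal.pow_mem_pow hxa t) ξ)) rfl
      refine Dies.comp ?_ _ _
      have : Module.Finite R ((R ⧸ p.asIdeal) ⧸ LinearMap.range f) := inferInstance
      refine Vanishes.of_forall_quotient_prime (.of R ((R ⧸ p.asIdeal) ⧸ LinearMap.range f))
        (fun q hq ↦ ?_) t η
      have hpq : p < q := PrimeSpectrum.lt_of_mem_support_of_surjective
        (Submodule.mkQ_surjective (LinearMap.range f)) hxt
        ((Submodule.Quotient.mk_eq_zero _).2 ⟨1,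
          congrArg (Ideal.Quotient.mk p.asIdeal) (mul_one (x ^ t))⟩) hq
      refine ih q ?_ j (by lia)
      have h₁ := Order.coheight_add_one_le hpq
      have h₂ := h₁.trans_lt hp
      push_cast at h₂
      exact lt_of_add_lt_add_right h₂

lemma exists_forall_vanishes (a : Ideal R) (hfin : ringKrullDim R ≠ ⊤) :
    ∃ d : ℕ, ∀ j ≥ d, ∀ (M : ModuleCat.{u} R) [Module.Finite R M], Vanishes a j M := by
  obtain ⟨d, hd⟩ : ∃ d : ℕ, ringKrullDim R < d := by
    cases h : ringKrullDim R with
    | bot => exact ⟨0, WithBot.bot_lt_coe _⟩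
    | coe n =>
      cases n with
      | top => exact absurd h hfin
      | coe n => exact ⟨n + 1, by exact_mod_cast n.lt_succ_self⟩
  refine ⟨d, fun j hj M _ ↦ Vanishes.of_forall_quotient_prime M fun q _ ↦
    vanishes_quotient_of_coheight_lt d q ?_ j hj⟩
  have := (Order.coheight_le_krullDim q).trans_lt hd
  exact_mod_cast this

end localCohomology

lemma Module.exists_linearMap_quotient_ne_zero {R M : Type*} [CommRing R] [AddCommGroup M]
    [Module R M] [Module.Finite R M] {q : PrimeSpectrum R} (hq : q ∈ Module.support R M) :
    ∃ f : M →ₗ[R] (R ⧸ q.asIdeal), f ≠ 0 := by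
  let k := q.asIdeal.ResidueField
  rw [Module.mem_support_iff_nontrivial_residueField_tensorProduct] at hq
  obtain ⟨z, hz⟩ := exists_ne (0 : k ⊗[R] M)
  obtain ⟨F, hF⟩ : ∃ F : Module.Dual k (k ⊗[R] M), F z ≠ 0 := by
    by_contra! h
    exact hz ((Module.forall_dual_apply_eq_zero_iff k z).1 h)
  let ψ : M →ₗ[R] k := F.restrictScalars R ∘ₗ TensorProduct.mk R k M 1
  obtain ⟨m, hm⟩ : ∃ m, ψ m ≠ 0 := by
    by_contra! h
    have : F = 0 := by
      refine TensorProduct.AlgebraTensorModule.ext fun x m ↦ ?_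
      have e : x ⊗ₜ[R] m = x • ((1 : k) ⊗ₜ[R] m) := by
        rw [TensorProduct.smul_tmul', smul_eq_mul, mul_one]
      rw [e, map_smul, show F ((1 : k) ⊗ₜ[R] m) = 0 from h m, smul_zero, LinearMap.zero_apply]
    exact hF (by rw [this, LinearMap.zero_apply])
  obtain ⟨s, hs⟩ := Module.Finite.fg_top (R := R) (M := M)
  classical
  obtain ⟨⟨b, hb⟩, hbs⟩ := IsLocalization.exist_integer_multiples_of_finset
    (nonZeroDivisors (R ⧸ q.asIdeal)) (s.image ψ)
  obtain ⟨r, rfl⟩ := Ideal.Quotient.mk_surjective b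
  have hr (x : k) : Ideal.Quotient.mk q.asIdeal r • x = r • x :=
    algebraMap_smul (R ⧸ q.asIdeal) r x
  let ι : (R ⧸ q.asIdeal) →ₗ[R] k := (Algebra.linearMap (R ⧸ q.asIdeal) k).restrictScalars R
  have hι : Function.Injective ι := IsFractionRing.injective (R ⧸ q.asIdeal) k
  have hmem (x : M) : (r • ψ) x ∈ LinearMap.range ι := by
    have hx : x ∈ Submodule.span R (s : Set M) := hs ▸ Submodule.mem_top
    have hle : Submodule.span R (s : Set M) ≤ (LinearMap.range ι).comap (r • ψ) := by
      refine Submodule.span_le.2 fun y hy ↦ ?_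
      obtain ⟨w, hw⟩ := hbs (ψ y) (Finset.mem_image_of_mem _ hy)
      exact ⟨w, hw.trans (hr _)⟩
    exact hle hx
  refine ⟨(LinearEquiv.ofInjective ι hι).symm.toLinearMap ∘ₗ LinearMap.codRestrict _ (r • ψ) hmem,
    fun h ↦ ?_⟩
  have h₁ := LinearMap.congr_fun h m
  rw [LinearMap.comp_apply, LinearMap.zero_apply, LinearEquiv.coe_coe,
    LinearEquiv.map_eq_zero_iff] at h₁
  have h₂ : r • ψ m = 0 := congrArg Subtype.val h₁
  rw [← hr, Algebra.smul_def, mul_eq_zero, or_iff_left hm] at h₂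
  exact nonZeroDivisors.ne_zero hb (hι (h₂.trans (map_zero ι).symm))

/-- A property of modules which is stable under extensions, and under the quotients of finitely
generated modules with support in the support of `M`, holds for all finitely generated modules
with support in the support of `M` if it holds for `M`. -/
lemma ModuleCat.prop_of_support_subset {R : Type u} [CommRing R] [IsNoetherianRing R]
    {P : ModuleCat.{u} R → Prop} (h0 : ∀ M, IsZero M → P M)
    (hext : ∀ S : ShortComplex (ModuleCat.{u} R), S.ShortExact → P S.X₁ → P S.X₃ → P S.X₂)
    (M : ModuleCat.{u} R) [Module.Finite R M] (hM : P M)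
    (hquot : ∀ S : ShortComplex (ModuleCat.{u} R), S.ShortExact → Module.Finite R S.X₂ →
      Module.support R S.X₂ ⊆ Module.support R M → P S.X₂ → P S.X₃)
    (L : ModuleCat.{u} R) [Module.Finite R L]
    (hL : Module.support R L ⊆ Module.support R M) : P L := by
  refine prop_of_forall_quotient_prime h0 hext L fun q hq ↦ ?_
  replace hq := hL hq
  induction q using (InvImage.wf PrimeSpectrum.asIdeal
    (wellFounded_gt (α := Ideal R))).induction with
  | _ q ih =>
  obtain ⟨f, hf⟩ := Module.exists_linearMap_quotient_ne_zero hq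
  obtain ⟨m, hm⟩ : ∃ m, f m ≠ 0 := by
    by_contra! h
    exact hf (LinearMap.ext h)
  obtain ⟨c, hc⟩ := Ideal.Quotient.mk_surjective (f m)
  have hcq : c ∉ q.asIdeal := fun h ↦ hm (hc ▸ Ideal.Quotient.eq_zero_iff_mem.2 h)
  have h₁ : P (.of R (LinearMap.range f)) :=
    hquot _ (LinearMap.shortExact_shortComplexKer f.surjective_rangeRestrict) ‹_› subset_rfl hM
  refine hext _ (ModuleCat.shortExact_of_function_exact (LinearMap.range f).injective_subtype
    (Submodule.mkQ_surjective _) (LinearMap.exact_subtype_mkQ _)) h₁ ?_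
  refine prop_of_forall_quotient_prime h0 hext (.of R ((R ⧸ q.asIdeal) ⧸ LinearMap.range f))
    fun p hp ↦ ?_
  have hqp : q < p := PrimeSpectrum.lt_of_mem_support_of_surjective
    (Submodule.mkQ_surjective (LinearMap.range f)) hcq
    ((Submodule.Quotient.mk_eq_zero _).2 ⟨m, hc.symm⟩) hp
  exact ih p hqp (Module.mem_support_mono hqp.le hq)

namespace localCohomology

variable {R : Type u} [CommRing R] [IsNoetherianRing R] {a : Ideal R}

lemma Vanishes.of_support_subset (hfin : ringKrullDim R ≠ ⊤) {n : ℕ} {L : ModuleCat.{u} R}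
    [Module.Finite R L] (hL : ∀ j ≥ n, Vanishes a j L) {j : ℕ} (hj : n ≤ j) (K : ModuleCat.{u} R)
    [Module.Finite R K] (hK : Module.support R K ⊆ Module.support R L) : Vanishes a j K := by
  obtain ⟨d, hd⟩ := exists_forall_vanishes a hfin
  obtain ⟨m, hm⟩ : ∃ m, d ≤ j + m := ⟨d, by lia⟩
  induction m generalizing j K with
  | zero => exact hd j hm K
  | succ m ih =>
    refine ModuleCat.prop_of_support_subset (fun _ hM ↦ vanishes_of_isZero hM)
      (fun _ hS h₁ h₃ ↦ h₁.of_shortExact_X₂ hS h₃) L (hL j hj) (fun S hS _ hsupp h₂ ↦ ?_) K hK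
    have hf : Function.Injective S.f.hom := hS.moduleCat_injective_f
    have : Module.Finite R S.X₁ := Module.Finite.of_injective S.f.hom hf
    exact h₂.of_shortExact_X₃ hS (ih (by lia) S.X₁
      ((Module.support_subset_of_injective S.f.hom hf).trans hsupp) (by lia))

end localCohomology

namespace ModuleCat

variable {R : Type u} [CommRing R] [IsNoetherianRing R]

lemma exists_smul_ext_eq_zero_of_prop (p : PrimeSpectrum R) (M N : ModuleCat.{u} R)
    [Module.Finite R M] (n : ℕ) (h : ∀ ξ : Abelian.Ext M N n, ∃ r ∉ p.asIdeal, r • ξ = 0)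
    (hquot : ∀ S : ShortComplex (ModuleCat.{u} R), S.ShortExact → Module.Finite R S.X₂ →
      Module.support R S.X₂ ⊆ Module.support R M →
      ∀ ξ : Abelian.Ext S.X₃ N n, (Abelian.Ext.mk₀ S.g).comp ξ (zero_add n) = 0 →
        ∃ r ∉ p.asIdeal, r • ξ = 0)
    (L : ModuleCat.{u} R) [Module.Finite R L]
    (hL : Module.support R L ⊆ Module.support R M) (ξ : Abelian.Ext L N n) :
    ∃ r ∉ p.asIdeal, r • ξ = 0 := by
  refine prop_of_support_subset (P := fun L ↦ ∀ ξ : Abelian.Ext L N n, ∃ r ∉ p.asIdeal, r • ξ = 0)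
    (fun K hK ξ ↦ ⟨1, p.2.one_notMem, ?_⟩) (fun S hS h₁ h₃ ξ ↦ ?_) M h
    (fun S hS hfin hsupp h₂ ξ ↦ ?_) L hL ξ
  · rw [← ξ.mk₀_id_comp, hK.eq_of_src (𝟙 K) 0, Abelian.Ext.mk₀_zero, Abelian.Ext.zero_comp,
      smul_zero]
  · obtain ⟨s, hs, e⟩ := h₁ ((Abelian.Ext.mk₀ S.f).comp ξ (zero_add n))
    rw [← Abelian.Ext.comp_smul] at e
    obtain ⟨η, hη⟩ := Abelian.Ext.contravariant_sequence_exact₂ hS _ (s • ξ) e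
    obtain ⟨t, ht, e'⟩ := h₃ η
    refine ⟨t * s, p.2.mul_notMem ht hs, ?_⟩
    rw [mul_smul, ← hη, ← Abelian.Ext.comp_smul, e', Abelian.Ext.comp_zero]
  · obtain ⟨s, hs, e⟩ := h₂ ((Abelian.Ext.mk₀ S.g).comp ξ (zero_add n))
    rw [← Abelian.Ext.comp_smul] at e
    obtain ⟨t, ht, e'⟩ := hquot S hS hfin hsupp (s • ξ) e
    exact ⟨t * s, p.2.mul_notMem ht hs, by rw [mul_smul, e']⟩

lemma exists_smul_ext_eq_zero_of_support_subset (p : PrimeSpectrum R)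
    (M N : ModuleCat.{u} R) [Module.Finite R M]
    (h : ∀ (i : ℕ) (ξ : Abelian.Ext M N i), ∃ r ∉ p.asIdeal, r • ξ = 0) (i : ℕ)
    (L : ModuleCat.{u} R) [Module.Finite R L]
    (hL : Module.support R L ⊆ Module.support R M) (ξ : Abelian.Ext L N i) :
    ∃ r ∉ p.asIdeal, r • ξ = 0 := by
  induction i generalizing L with
  | zero =>
    refine exists_smul_ext_eq_zero_of_prop p M N 0 (h 0) (fun S hS _ _ ξ e ↦ ?_) L hL ξ
    have := hS.epi_g
    obtain rfl : ξ = 0 := Abelian.Ext.precomp_mk₀_injective_of_epi N S.g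
      (e.trans (Abelian.Ext.comp_zero (Abelian.Ext.mk₀ S.g) N 0 0 (zero_add 0)).symm)
    exact ⟨1, p.2.one_notMem, smul_zero _⟩
  | succ i ih =>
    refine exists_smul_ext_eq_zero_of_prop p M N (i + 1) (h (i + 1))
      (fun S hS _ hsupp ξ e ↦ ?_) L hL ξ
    obtain ⟨η, hη⟩ := Abelian.Ext.contravariant_sequence_exact₃ hS _ ξ e (add_comm 1 i)
    have hf : Function.Injective S.f.hom := hS.moduleCat_injective_f
    have : Module.Finite R S.X₁ := Module.Finite.of_injective S.f.hom hf
    obtain ⟨t, ht, e'⟩ := ih S.X₁ ((Module.support_subset_of_injective S.f.hom hf).trans hsupp) η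
    exact ⟨t, ht, by rw [← hη, ← Abelian.Ext.comp_smul, e', Abelian.Ext.comp_zero]⟩

lemma exists_mem_support_ext (M N : ModuleCat.{u} R) [Module.Finite R M]
    (hsupp : Module.support R N ⊆ Module.support R M) (p : PrimeSpectrum R)
    (hp : p ∈ Module.support R N) : ∃ i, p ∈ Module.support R (Abelian.Ext M N i) := by
  by_contra! h
  obtain ⟨m, hm⟩ := Module.mem_support_iff_exists_annihilator.1 hp
  let f : (R ∙ m) →ₗ[R] N := (R ∙ m).subtype
  obtain ⟨r, hr, e⟩ := exists_smul_ext_eq_zero_of_support_subset p M N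
    (fun i ξ ↦ Module.notMem_support_iff'.1 (h i) ξ) 0 (.of R (R ∙ m))
    ((Module.support_subset_of_injective f Subtype.val_injective).trans hsupp)
    (Abelian.Ext.mk₀ (ofHom f))
  rw [← Abelian.Ext.mk₀_smul, Abelian.Ext.mk₀_eq_zero_iff] at e
  have e' : r • m = 0 :=
    congrArg (fun g ↦ g.hom ⟨m, Submodule.mem_span_singleton_self m⟩) e
  exact hr (hm ((Submodule.mem_annihilator_span_singleton _ _).2 e'))

end ModuleCat

/-- Theorem 3.3(ii) / Corollary 3.4, module case: over a commutative Noetherian ring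
`R` of finite Krull dimension, if `M`, `N` are finitely generated, `M` has finite
projective dimension and `Supp_R N ⊆ Supp_R M`, then
`cd(a, N) ≤ sup_i (cd(a, Ext^i_R(M, N)) + i)`. -/
theorem cohDim_le_iSup_cohDim_ext_add (R : Type u) [CommRing R] [IsNoetherianRing R]
    (hfin : ringKrullDim R ≠ ⊤) (a : Ideal R)
    (M N : ModuleCat.{u} R) [Module.Finite R M] [Module.Finite R N]
    (hpd : ∃ n : ℕ, projDimLE R M n)
    (hsupp : Module.support R N ⊆ Module.support R M) :
    cohDim R a N ≤ ⨆ i : ℕ, (cohDim R a (extMod R i M N) + (i : WithBot ℕ∞)) := by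
  refine iSup₂_le fun j (hj : ¬ Subsingleton _) ↦ ?_
  rw [localCohomology.subsingleton_iff_vanishes] at hj
  obtain ⟨p, hp, hpj⟩ : ∃ p ∈ Module.support R N,
      ¬ localCohomology.Vanishes a j (.of R (R ⧸ p.asIdeal)) := by
    by_contra! h
    exact hj (.of_forall_quotient_prime N h)
  obtain ⟨i, hi⟩ := ModuleCat.exists_mem_support_ext M N hsupp p hp
  let e : extMod R i M N ≃ₗ[R] Abelian.Ext M N i := (projectiveResolution M).extEquiv R N i
  rw [← e.support_eq] at hi
  have : Module.Finite R (extMod R i M N) := Module.Finite.equiv e.symm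
  obtain ⟨k, hk, hjk⟩ : ∃ k ≥ j, ¬ localCohomology.Vanishes a k (extMod R i M N) := by
    by_contra! h
    exact hpj (.of_support_subset hfin h le_rfl _ fun q hq ↦
      Module.mem_support_mono (PrimeSpectrum.mem_support_quotient_iff.1 hq) hi)
  rw [← localCohomology.subsingleton_iff_vanishes] at hjk
  calc (j : WithBot ℕ∞) ≤ (k : WithBot ℕ∞) := by exact_mod_cast hk
    _ ≤ cohDim R a (extMod R i M N) := le_iSup₂_of_le k hjk le_rfl
    _ ≤ cohDim R a (extMod R i M N) + (i : WithBot ℕ∞) := le_add_of_nonneg_right (by positivity)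
    _ ≤ _ := le_iSup (fun i : ℕ ↦ cohDim R a (extMod R i M N) + (i : WithBot ℕ∞)) i
end
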